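/- Let (R, m) be a commutative Noetherian local ring. Then R is Gorenstein if and only if the following two conditions hold: (a) for any parameter ideals a and b of R with b ⊆ a, Hom_R(R/a, R/b) ≅ R/a as R-modules; and (b) there exists an irreducible parameter ideal of R. -/

import Mathlib

open IsLocalRing

/-- A parameter ideal of a Noetherian local ring: an ideal generated by a system of
parameters, i.e. by `d` elements of the maximal ideal (where `d` is the Krull dimension
of the ring) generating an ideal whose radical is the maximal ideal. -/
def IsParameterIdeal (R : Type*) [CommRing R] [IsLocalRing R] (I : Ideal R) : Prop :=
  ∃ (d : ℕ) (a : Fin d → R), ringKrullDim R = d ∧ (∀ i, a i ∈ maximalIdeal R) ∧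
    I = Ideal.span (Set.range a) ∧ I.radical = maximalIdeal R

/-- A ring is Gorenstein if it has finite injective dimension as a module over itself,
i.e. it admits an injective resolution vanishing in all sufficiently large degrees. -/
def HasFiniteInjectiveDimension (R : Type*) [CommRing R] : Prop :=
  ∃ (n : ℕ) (J : CategoryTheory.InjectiveResolution (ModuleCat.of R R)),
    ∀ i, n < i → CategoryTheory.Limits.IsZero (J.cocomplex.X i)

/-- An ideal is irreducible if it is proper and whenever it is the intersection of two
ideals it equals one of them. -/
def IsIrreducibleIdeal {R : Type*} [CommRing R] (I : Ideal R) : Prop :=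
  I ≠ ⊤ ∧ ∀ J K : Ideal R, I = J ⊓ K → I = J ∨ I = K

universe u

open CategoryTheory Limits in
theorem CategoryTheory.InjectiveResolution.hasInjectiveDimensionLT_of_isZero
    {C : Type*} [Category C] [Abelian C] [HasExt C] [EnoughProjectives C] {Z : C}
    (J : InjectiveResolution Z) (n : ℕ) (h : IsZero (J.cocomplex.X n)) :
    HasInjectiveDimensionLT Z n := by
  refine hasInjectiveDimensionLT_of_enoughProjectives Z n fun Y ↦ ⟨fun a b ↦ ?_⟩
  obtain ⟨f, hf, rfl⟩ := J.extMk_surjective a _ rfl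
  obtain ⟨g, hg, rfl⟩ := J.extMk_surjective b _ rfl
  obtain rfl := h.eq_of_tgt f g
  rfl

open CategoryTheory Limits in
/-- Splicing an injective resolution of the cokernel onto an embedding into an injective object. -/
theorem CategoryTheory.InjectiveResolution.exists_of_shortExact
    {C : Type*} [Category C] [Abelian C] {S : ShortComplex C} (hS : S.ShortExact)
    [Injective S.X₂] (J : InjectiveResolution S.X₃) :
    ∃ K : InjectiveResolution S.X₁, ∀ i, K.cocomplex.X (i + 1) = J.cocomplex.X i := by
  have := hS.mono_f
  have := hS.epi_g
  obtain ⟨g, hg, hmono, hexact⟩ : ∃ (g : S.X₃ ⟶ J.cocomplex.X 0)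
      (hg : g ≫ J.cocomplex.d 0 1 = 0), Mono g ∧ (ShortComplex.mk g _ hg).Exact :=
    ⟨J.ι.f 0, J.ι_f_zero_comp_complex_d, inferInstanceAs (Mono (J.ι.f 0)), J.exact₀⟩
  have hf : (S.g ≫ g) ≫ J.cocomplex.d 0 1 = 0 := by simp [hg]
  let K := J.cocomplex.augment (S.g ≫ g) hf
  have hK : (S.f : S.X₁ ⟶ K.X 0) ≫ K.d 0 1 = 0 := by
    change S.f ≫ S.g ≫ g = 0
    simp
  have h := CochainComplex.fromSingle₀Equiv_symm_apply_f_zero (C := K) S.f hK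
  refine ⟨⟨K, ?_, (CochainComplex.fromSingle₀Equiv _ _).symm ⟨S.f, hK⟩, ⟨fun n ↦ ?_⟩⟩, fun i ↦ rfl⟩
  · rintro (_ | n)
    · assumption
    · exact J.injective n
  · cases n with
    | zero =>
      rw [CochainComplex.quasiIsoAt₀_iff, ShortComplex.quasiIso_iff_of_zeros]
      · have : (ShortComplex.mk S.f (S.g ≫ g) (by simp)).Exact := by
          refine (ShortComplex.exact_iff_of_epi_of_isIso_of_mono
            (S₁ := S) (S₂ := ShortComplex.mk S.f (S.g ≫ g) (by simp))
            { τ₁ := 𝟙 _, τ₂ := 𝟙 _, τ₃ := g }).1 hS.exact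
        refine (ShortComplex.exact_and_mono_f_iff_of_iso ?_).2 ⟨this, by dsimp; infer_instance⟩
        exact ShortComplex.isoMk (Iso.refl _) (Iso.refl _) (Iso.refl _)
          ((Category.id_comp _).trans (h.symm.trans (Category.comp_id _).symm))
          ((Category.id_comp _).trans (Category.comp_id _).symm)
      all_goals rfl
    | succ n =>
      rw [quasiIsoAt_iff_exactAt]
      · rw [HomologicalComplex.exactAt_iff' _ n (n + 1) (n + 1 + 1) (by simp) (by simp)]
        match n with
        | 0 =>
          exact (ShortComplex.exact_iff_of_epi_of_isIso_of_mono
            (S₁ := ShortComplex.mk (S.g ≫ g) (J.cocomplex.d 0 1) hf)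
            (S₂ := ShortComplex.mk g (J.cocomplex.d 0 1) hg)
            { τ₁ := S.g, τ₂ := 𝟙 _, τ₃ := 𝟙 _ }).2 hexact
        | n + 1 => exact J.exact_succ n
      · apply CochainComplex.exactAt_succ_single_obj

open CategoryTheory Limits in
theorem CategoryTheory.exists_injectiveResolution_of_hasInjectiveDimensionLT
    {C : Type*} [Category C] [Abelian C] [EnoughInjectives C] (n : ℕ) (Z : C)
    [HasInjectiveDimensionLT Z (n + 1)] :
    ∃ J : InjectiveResolution Z, ∀ i, n < i → IsZero (J.cocomplex.X i) := by
  induction n generalizing Z with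
  | zero =>
    have : Injective Z := injective_iff_hasInjectiveDimensionLT_one.2 ‹_›
    refine ⟨InjectiveResolution.self Z, fun i hi ↦ ?_⟩
    exact HomologicalComplex.isZero_single_obj_X _ _ _ _ hi.ne'
  | succ n ih =>
    let ip := (EnoughInjectives.presentation Z).some
    have := ip.injective
    have hS := ip.shortExact_shortComplex
    have := hS.hasInjectiveDimensionLT_X₃ (n + 1) inferInstance ‹_›
    obtain ⟨J, hJ⟩ := ih ip.shortComplex.X₃
    obtain ⟨K, hK⟩ := InjectiveResolution.exists_of_shortExact hS J
    refine ⟨K, fun i hi ↦ ?_⟩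
    obtain ⟨i, rfl⟩ : ∃ j, i = j + 1 := ⟨i - 1, by lia⟩
    rw [hK]
    exact hJ i (by lia)

open CategoryTheory in
theorem hasFiniteInjectiveDimension_iff (R : Type*) [CommRing R] :
    HasFiniteInjectiveDimension R ↔ ∃ n, HasInjectiveDimensionLT (ModuleCat.of R R) n := by
  constructor
  · rintro ⟨n, J, hJ⟩
    exact ⟨_, J.hasInjectiveDimensionLT_of_isZero (n + 1) (hJ _ n.lt_succ_self)⟩
  · rintro ⟨n, hn⟩
    have := hasInjectiveDimensionLT_of_ge (ModuleCat.of R R) n (n + 1) n.le_succ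
    obtain ⟨J, hJ⟩ := exists_injectiveResolution_of_hasInjectiveDimensionLT n (ModuleCat.of R R)
    exact ⟨n, J, hJ⟩

/-- The `R`-module `M` has an injective resolution of length less than `n`. -/
abbrev Module.InjDimLT (R : Type u) [Ring R] (M : Type u) [AddCommGroup M] [Module R M] (n : ℕ) :
    Prop :=
  CategoryTheory.HasInjectiveDimensionLT (ModuleCat.of R M) n

namespace Module.InjDimLT

section

variable {R : Type u} [Ring R] {A B C : Type u} [AddCommGroup A] [Module R A]
  [AddCommGroup B] [Module R B] [AddCommGroup C] [Module R C]

theorem mono {m n : ℕ} (h : InjDimLT R A m) (hmn : m ≤ n) : InjDimLT R A n :=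
  CategoryTheory.hasInjectiveDimensionLT_of_ge _ m n hmn

theorem one_iff : InjDimLT R A 1 ↔ Module.Injective R A := by
  rw [InjDimLT, ← CategoryTheory.injective_iff_hasInjectiveDimensionLT_one,
    Module.injective_iff_injective_object]

theorem of_retract (i : A →ₗ[R] B) (r : B →ₗ[R] A) (hri : ∀ a, r (i a) = a) {n : ℕ}
    (h : InjDimLT R B n) : InjDimLT R A n := by
  have e : CategoryTheory.Retract (ModuleCat.of R A) (ModuleCat.of R B) :=
    { i := ModuleCat.ofHom i
      r := ModuleCat.ofHom r
      retract := by ext a; exact hri a }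
  exact e.hasInjectiveDimensionLT n

variable {f : A →ₗ[R] B} {g : B →ₗ[R] C}

theorem shortExact (hf : Function.Injective f) (hfg : Function.Exact f g)
    (hg : Function.Surjective g) :
    (ModuleCat.shortComplexOfCompEqZero f g hfg.linearMap_comp_eq_zero).ShortExact :=
  ModuleCat.shortComplex_shortExact
    (ModuleCat.shortComplexOfCompEqZero f g hfg.linearMap_comp_eq_zero) hfg hf hg

theorem left (hf : Function.Injective f) (hfg : Function.Exact f g)
    (hg : Function.Surjective g) {n : ℕ} (hC : InjDimLT R C n) (hB : InjDimLT R B (n + 1)) :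
    InjDimLT R A (n + 1) :=
  (shortExact hf hfg hg).hasInjectiveDimensionLT_X₁ n hC hB

theorem right (hf : Function.Injective f) (hfg : Function.Exact f g)
    (hg : Function.Surjective g) {n : ℕ} (hB : InjDimLT R B n) (hA : InjDimLT R A (n + 1)) :
    InjDimLT R C n :=
  (shortExact hf hfg hg).hasInjectiveDimensionLT_X₃ n hB hA

end

theorem _root_.Module.exists_injective_embedding (R M : Type u) [Ring R] [AddCommGroup M]
    [Module R M] :
    ∃ (E : Type u) (_ : AddCommGroup E) (_ : Module R E) (f : M →ₗ[R] E),
      Module.Injective R E ∧ Function.Injective f := by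
  let ⟨I, _, f, _⟩ := CategoryTheory.EnoughInjectives.presentation (ModuleCat.of R M)
  exact ⟨I, _, _, f.hom, Module.injective_module_of_injective_object R I,
    (ModuleCat.mono_iff_injective f).mp ‹_›⟩

section quotSpanSingleton

variable {R : Type u} [CommRing R] {x : R}

open Submodule

theorem _root_.Module.injective_torsionBy {E : Type u} [AddCommGroup E] [Module R E]
    (hE : Module.Injective R E) (x : R) :
    Module.Injective (R ⧸ Ideal.span {x}) (torsionBy R E x) := by
  apply Module.Baer.injective
  intro I g
  let J := I.comap (Ideal.Quotient.mk (Ideal.span {x}))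
  let φ : J →ₗ[R] E :=
    { toFun := fun j ↦ (g ⟨Ideal.Quotient.mk _ j.1, j.2⟩ : torsionBy R E x)
      map_add' := fun a b ↦ by
        rw [← Submodule.coe_add, ← map_add]; rfl
      map_smul' := fun r a ↦ by
        have := g.map_smul (Ideal.Quotient.mk _ r) ⟨Ideal.Quotient.mk _ a.1, a.2⟩
        rw [torsionBy.mk_ideal_smul] at this
        simp only [RingHom.id_apply]
        rw [← Submodule.coe_smul, ← this]
        rfl }
  obtain ⟨ψ, hψ⟩ := Module.Baer.of_injective hE J φ
  have h1 : ∀ j (hj : j ∈ J), φ ⟨j, hj⟩ = j • ψ 1 := fun j hj ↦ by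
    rw [← hψ j hj, ← map_smul, smul_eq_mul, mul_one]
  have hx : x • ψ 1 = 0 := by
    have hxJ : x ∈ J := by
      change Ideal.Quotient.mk _ x ∈ I
      rw [Ideal.Quotient.eq_zero_iff_mem.2 (Ideal.mem_span_singleton_self x)]
      exact I.zero_mem
    rw [← h1 x hxJ]
    have : (⟨Ideal.Quotient.mk _ x, hxJ⟩ : I) = 0 :=
      Subtype.ext (Ideal.Quotient.eq_zero_iff_mem.2 (Ideal.mem_span_singleton_self x))
    change ((g ⟨Ideal.Quotient.mk _ x, hxJ⟩ : torsionBy R E x) : E) = 0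
    rw [this, map_zero]; rfl
  refine ⟨LinearMap.toSpanSingleton _ _ ⟨ψ 1, hx⟩, fun s hs ↦ ?_⟩
  obtain ⟨r, rfl⟩ := Ideal.Quotient.mk_surjective s
  rw [LinearMap.toSpanSingleton_apply, torsionBy.mk_ideal_smul]
  exact Subtype.ext ((h1 r hs).symm.trans rfl)

/-- The map induced on `x`-torsion, as a map of modules over `R ⧸ (x)`. -/
def _root_.Submodule.torsionByMap {A B : Type*} [AddCommGroup A] [Module R A]
    [AddCommGroup B] [Module R B] (x : R) (f : A →ₗ[R] B) :
    torsionBy R A x →ₗ[R ⧸ Ideal.span {x}] torsionBy R B x where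
  toFun a := ⟨f a, by
    have h := a.2
    rw [mem_torsionBy_iff] at h ⊢
    rw [← map_smul, h, map_zero]⟩
  map_add' a b := Subtype.ext (map_add f _ _)
  map_smul' s a := by
    obtain ⟨r, rfl⟩ := Ideal.Quotient.mk_surjective s
    exact Subtype.ext (map_smul f r _)

@[simp]
theorem _root_.Submodule.coe_torsionByMap {A B : Type*} [AddCommGroup A] [Module R A]
    [AddCommGroup B] [Module R B] (x : R) (f : A →ₗ[R] B) (a : torsionBy R A x) :
    (torsionByMap x f a : B) = f a := rfl

theorem _root_.Module.Injective.exists_smul_eq {E : Type u} [AddCommGroup E] [Module R E]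
    (hE : Module.Injective R E) (hx : IsSMulRegular R x) (e : E) : ∃ e', x • e' = e := by
  obtain ⟨h, hh⟩ := Module.Injective.extension_property R _ _ _ (LinearMap.lsmul R R x) hx
    (LinearMap.toSpanSingleton R E e)
  refine ⟨h 1, ?_⟩
  have := LinearMap.congr_fun hh 1
  simp only [LinearMap.comp_apply, LinearMap.lsmul_apply, LinearMap.toSpanSingleton_apply] at this
  rw [← map_smul, this, one_smul]

theorem torsion (hx : IsSMulRegular R x) {n : ℕ} {C : Type u} [AddCommGroup C] [Module R C]
    (hdiv : ∀ c : C, ∃ c', x • c' = c) (h : InjDimLT R C (n + 1)) :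
    InjDimLT (R ⧸ Ideal.span {x}) (torsionBy R C x) (n + 1) := by
  induction n generalizing C with
  | zero => exact one_iff.2 (Module.injective_torsionBy (one_iff.1 h) x)
  | succ n ih =>
    obtain ⟨E, _, _, f, hE, hf⟩ := Module.exists_injective_embedding R C
    have hE1 : InjDimLT R E 1 := one_iff.2 hE
    have hC' : InjDimLT R (E ⧸ f.range) (n + 1) :=
      right hf f.exact_map_mkQ_range (mkQ_surjective _) (hE1.mono (by lia)) h
    have key := ih (C := E ⧸ f.range) (fun c ↦ by
      obtain ⟨e, rfl⟩ := mkQ_surjective _ c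
      obtain ⟨e', rfl⟩ := hE.exists_smul_eq hx e
      exact ⟨mkQ _ e', rfl⟩) hC'
    refine left (f := torsionByMap x f) (g := torsionByMap x f.range.mkQ) ?_ ?_ ?_ key
      ((one_iff.2 (Module.injective_torsionBy hE x)).mono (by lia))
    · intro a b hab
      exact Subtype.ext (hf (congrArg Subtype.val hab))
    · rintro ⟨e, he⟩
      constructor
      · intro h0
        have : f.range.mkQ e = 0 := congrArg Subtype.val h0
        obtain ⟨c, rfl⟩ := (f.exact_map_mkQ_range e).1 this
        refine ⟨⟨c, ?_⟩, rfl⟩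
        rw [mem_torsionBy_iff] at he ⊢
        rw [← map_smul] at he
        exact hf (he.trans (map_zero f).symm)
      · rintro ⟨c, hc⟩
        rw [← hc]
        exact Subtype.ext (f.exact_map_mkQ_range.apply_apply_eq_zero c.1)
    · rintro ⟨c, hc⟩
      obtain ⟨e, rfl⟩ := mkQ_surjective _ c
      rw [mem_torsionBy_iff, ← map_smul] at hc
      obtain ⟨c, hc⟩ := (f.exact_map_mkQ_range _).1 hc
      obtain ⟨c', rfl⟩ := hdiv c
      refine ⟨⟨e - f c', ?_⟩, Subtype.ext ?_⟩
      · rw [mem_torsionBy_iff, smul_sub, ← hc, map_smul, sub_self]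
      · rw [coe_torsionByMap, map_sub, f.exact_map_mkQ_range.apply_apply_eq_zero, sub_zero]

end quotSpanSingleton

end Module.InjDimLT

open CategoryTheory Abelian in
theorem Module.InjDimLT.subsingleton_ext {R : Type u} [CommRing R] {N M : Type u} [AddCommGroup N]
    [Module R N] [AddCommGroup M] [Module R M] {n : ℕ} (h : Module.InjDimLT R M n) :
    Subsingleton (Ext (ModuleCat.of R N) (ModuleCat.of R M) n) :=
  subsingleton_of_forall_eq 0 fun e ↦ e.eq_zero_of_hasInjectiveDimensionLT n le_rfl

open CategoryTheory Abelian in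
/-- Baer's criterion for injective dimension. -/
theorem Module.InjDimLT.of_subsingleton_ext {R : Type u} [CommRing R] {M : Type u} [AddCommGroup M]
    [Module R M] {n : ℕ}
    (h : ∀ I : Ideal R, Subsingleton (Ext (ModuleCat.of R (R ⧸ I)) (ModuleCat.of R M) (n + 1))) :
    Module.InjDimLT R M (n + 1) := by
  induction n generalizing M with
  | zero =>
    rw [one_iff]
    apply Module.Baer.injective
    intro I g
    have hS := shortExact (Subtype.val_injective) (LinearMap.exact_subtype_mkQ I)
      (Submodule.mkQ_surjective I)
    obtain ⟨e, he⟩ := Ext.contravariant_sequence_exact₁ hS (ModuleCat.of R M)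
      (Ext.mk₀ (ModuleCat.ofHom g)) (n₁ := 1) rfl ((h I).elim _ _)
    obtain ⟨e, rfl⟩ := (Ext.mk₀_bijective _ _).2 e
    rw [Ext.mk₀_comp_mk₀] at he
    have := (Ext.mk₀_bijective _ _).1 he
    exact ⟨e.hom, fun x hx ↦ ConcreteCategory.congr_hom this ⟨x, hx⟩⟩
  | succ n ih =>
    obtain ⟨E, _, _, f, hE, hf⟩ := Module.exists_injective_embedding R M
    have hE1 : InjDimLT R E 1 := one_iff.2 hE
    refine left hf f.exact_map_mkQ_range (Submodule.mkQ_surjective _) (ih fun I ↦ ?_)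
      (hE1.mono (by lia))
    have hS := shortExact hf f.exact_map_mkQ_range (Submodule.mkQ_surjective _)
    refine subsingleton_of_forall_eq 0 fun e ↦ ?_
    obtain ⟨e', rfl⟩ := Ext.covariant_sequence_exact₃ _ hS e rfl ((h I).elim _ _)
    have h1 : Subsingleton (Ext (ModuleCat.of R (R ⧸ I)) (ModuleCat.of R E) (n + 1)) :=
      (hE1.mono (by lia)).subsingleton_ext
    have h2 : e' = 0 := h1.elim _ _
    rw [h2, Ext.zero_comp]

section

open Submodule

variable {R : Type u} [CommRing R] {x : R}

theorem Module.InjDimLT.quotient_span_singleton (hx : IsSMulRegular R x) {n : ℕ}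
    (h : Module.InjDimLT R R (n + 2)) :
    Module.InjDimLT (R ⧸ Ideal.span {x}) (R ⧸ Ideal.span {x}) (n + 1) := by
  obtain ⟨E, _, _, ι, hE, hι⟩ := Module.exists_injective_embedding R R
  have hC : InjDimLT R (E ⧸ ι.range) (n + 1) :=
    right hι ι.exact_map_mkQ_range (mkQ_surjective _) ((one_iff.2 hE).mono (by lia)) h
  have hT := hC.torsion hx fun c ↦ by
    obtain ⟨e, rfl⟩ := mkQ_surjective _ c
    obtain ⟨e', rfl⟩ := hE.exists_smul_eq hx e
    exact ⟨mkQ _ e', rfl⟩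
  have hker : ∀ e : E, ι.range.mkQ e = 0 ↔ ∃ r, ι r = e := fun e ↦ ι.exact_map_mkQ_range e
  obtain ⟨e₁, he₁⟩ := hE.exists_smul_eq hx (ι 1)
  have hex : ∀ c : torsionBy R (E ⧸ ι.range) x, ∃ s : R ⧸ Ideal.span {x}, ∃ (r : R) (e : E),
      s = Ideal.Quotient.mk _ r ∧ ι.range.mkQ e = c ∧ x • e = ι r := by
    rintro ⟨c, hc⟩
    obtain ⟨e, rfl⟩ := mkQ_surjective _ c
    rw [mem_torsionBy_iff, ← map_smul, hker] at hc
    obtain ⟨r, hr⟩ := hc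
    exact ⟨_, r, e, rfl, rfl, hr.symm⟩
  have huniq : ∀ (r r' : R) (e e' : E), ι.range.mkQ e = ι.range.mkQ e' → x • e = ι r →
      x • e' = ι r' → Ideal.Quotient.mk (Ideal.span {x}) r = Ideal.Quotient.mk _ r' := by
    intro r r' e e' h1 h2 h3
    rw [← sub_eq_zero, ← map_sub, hker] at h1
    obtain ⟨t, ht⟩ := h1
    rw [Ideal.Quotient.mk_eq_mk_iff_sub_mem, Ideal.mem_span_singleton]
    refine ⟨t, hι ?_⟩
    rw [map_sub, ← h2, ← h3, ← smul_sub, ← ht, ← map_smul, smul_eq_mul]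
  choose ρ hρ using hex
  have key : ∀ (c : torsionBy R (E ⧸ ι.range) x) (r : R) (e : E), ι.range.mkQ e = c →
      x • e = ι r → ρ c = Ideal.Quotient.mk _ r := by
    intro c r e h1 h2
    obtain ⟨r', e', h3, h4, h5⟩ := hρ c
    rw [h3]
    exact huniq _ _ _ _ (h4.trans h1.symm) h5 h2
  have hmem : ι.range.mkQ e₁ ∈ torsionBy R (E ⧸ ι.range) x := by
    rw [mem_torsionBy_iff, ← map_smul, he₁, hker]
    exact ⟨1, rfl⟩
  refine of_retract (LinearMap.toSpanSingleton _ _ ⟨_, hmem⟩)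
    { toFun := ρ, map_add' := ?_, map_smul' := ?_ } ?_ hT
  · intro c c'
    obtain ⟨r, e, h1, h2, h3⟩ := hρ c
    obtain ⟨r', e', h1', h2', h3'⟩ := hρ c'
    rw [h1, h1', ← map_add]
    apply key _ _ (e + e')
    · rw [map_add, h2, h2']; rfl
    · rw [smul_add, h3, h3', map_add]
  · intro s c
    obtain ⟨t, rfl⟩ := Ideal.Quotient.mk_surjective s
    obtain ⟨r, e, h1, h2, h3⟩ := hρ c
    rw [h1, RingHom.id_apply, smul_eq_mul, ← map_mul]
    apply key _ _ (t • e)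
    · rw [map_smul, h2]; rfl
    · rw [smul_comm, h3, ← map_smul, smul_eq_mul]
  · intro s
    obtain ⟨t, rfl⟩ := Ideal.Quotient.mk_surjective s
    apply key _ _ (t • e₁)
    · rw [map_smul]; rfl
    · rw [smul_comm, he₁, ← map_smul, smul_eq_mul, mul_one]

theorem Module.InjDimLT.of_quotient_span_singleton (hx : IsSMulRegular R x) {n : ℕ} {Q : Type u}
    [AddCommGroup Q] [Module R Q] [Module (R ⧸ Ideal.span {x}) Q]
    [IsScalarTower R (R ⧸ Ideal.span {x}) Q] (h : Module.InjDimLT (R ⧸ Ideal.span {x}) Q (n + 1)) :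
    Module.InjDimLT R Q (n + 2) := by
  induction n generalizing Q with
  | zero =>
    obtain ⟨E, _, _, f, hE, hf⟩ := Module.exists_injective_embedding R Q
    have hxQ (q : Q) : x • q = 0 := by
      rw [← algebraMap_smul (R ⧸ Ideal.span {x}), Ideal.Quotient.algebraMap_eq,
        Ideal.Quotient.eq_zero_iff_mem.2 (Ideal.mem_span_singleton_self x), zero_smul]
    let f' : Q →ₗ[R ⧸ Ideal.span {x}] torsionBy R E x :=
      { toFun := fun q ↦ ⟨f q, by rw [mem_torsionBy_iff, ← map_smul, hxQ, map_zero]⟩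
        map_add' := fun a b ↦ Subtype.ext (map_add f a b)
        map_smul' := fun s q ↦ by
          obtain ⟨r, rfl⟩ := Ideal.Quotient.mk_surjective s
          rw [← Ideal.Quotient.algebraMap_eq, algebraMap_smul]
          exact Subtype.ext (map_smul f r q) }
    have hQ := one_iff.1 h
    obtain ⟨ρ, hρ⟩ := hQ.extension_property _ _ _ _ f'
      (fun a b hab ↦ hf (congrArg Subtype.val hab)) LinearMap.id
    let ρ' : torsionBy R E x →ₗ[R] Q :=
      { toFun := ρ
        map_add' := map_add ρ
        map_smul' := fun r e ↦ by
          have := map_smul ρ (Ideal.Quotient.mk _ r) e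
          rw [← Ideal.Quotient.algebraMap_eq, algebraMap_smul] at this
          exact this.trans (algebraMap_smul _ r _) }
    refine of_retract (B := torsionBy R E x)
      (f.codRestrict _ fun q ↦ by rw [mem_torsionBy_iff, ← map_smul, hxQ, map_zero]) ρ'
      (fun q ↦ LinearMap.congr_fun hρ q) ?_
    have hE1 : InjDimLT R E 1 := one_iff.2 hE
    exact left (f := (torsionBy R E x).subtype) (g := LinearMap.lsmul R E x) Subtype.val_injective
      (fun e ↦ ⟨fun he ↦ ⟨⟨e, he⟩, rfl⟩, by rintro ⟨e, rfl⟩; exact e.2⟩)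
      (hE.exists_smul_eq hx) hE1 (hE1.mono (by lia))
  | succ n ih =>
    obtain ⟨E, _, _, f, hE, hf⟩ := Module.exists_injective_embedding (R ⧸ Ideal.span {x}) Q
    let _ : Module R E := Module.compHom E (algebraMap R (R ⧸ Ideal.span {x}))
    have : IsScalarTower R (R ⧸ Ideal.span {x}) E := ⟨fun r s e ↦ by
      rw [Algebra.smul_def, mul_smul]; rfl⟩
    have hE1 : InjDimLT (R ⧸ Ideal.span {x}) E 1 := one_iff.2 hE
    have hE2 : InjDimLT R E (n + 2) := ih (hE1.mono (by lia))
    have hC : InjDimLT (R ⧸ Ideal.span {x}) (E ⧸ f.range) (n + 1) :=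
      right hf f.exact_map_mkQ_range (mkQ_surjective _) (hE1.mono (by lia)) h
    have hQ : InjDimLT R (E ⧸ f.range) (n + 2) := ih hC
    let f' : Q →ₗ[R] E := f.restrictScalars R
    let g' : E →ₗ[R] E ⧸ f.range := f.range.mkQ.restrictScalars R
    have hf' : Function.Injective f' := hf
    have hfg' : Function.Exact f' g' := fun e ↦ by
      rw [LinearMap.restrictScalars_apply, mkQ_apply, Quotient.mk_eq_zero]
      exact Iff.rfl
    have hg' : Function.Surjective g' := f.range.mkQ_surjective
    have hE3 : InjDimLT R E (n + 1 + 1 + 1) := hE2.mono (by lia)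
    exact left hf' hfg' hg' hQ hE3

end

section

open CategoryTheory Abelian IsLocalRing

variable {R : Type u} [CommRing R] [IsNoetherianRing R] [IsLocalRing R]

theorem subsingleton_ext_of_smul_surjective {N M : Type u} [AddCommGroup N]
    [Module R N] [Module.Finite R N] [AddCommGroup M] [Module R M] [Module.Finite R M] {n : ℕ}
    {x : R} (hx : x ∈ maximalIdeal R)
    (h : ∀ e : Ext (ModuleCat.of R N) (ModuleCat.of R M) n, ∃ e', x • e' = e) :
    Subsingleton (Ext (ModuleCat.of R N) (ModuleCat.of R M) n) := by
  have : Module.Finite R (Ext (ModuleCat.of R N) (ModuleCat.of R M) n) := inferInstance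
  rw [← Submodule.subsingleton_iff R, ← subsingleton_iff_bot_eq_top, eq_comm]
  refine Submodule.eq_bot_of_le_smul_of_le_jacobson_bot (Ideal.span {x}) _ this.1 ?_ ?_
  · intro e _
    obtain ⟨e', rfl⟩ := h e
    exact Submodule.smul_mem_smul (Ideal.mem_span_singleton_self x) trivial
  · rw [IsLocalRing.jacobson_eq_maximalIdeal _ bot_ne_top, Ideal.span_singleton_le_iff_mem]
    exact hx

theorem Module.InjDimLT.of_quotient_self {x : R} (hxm : x ∈ maximalIdeal R)
    (hx : IsSMulRegular R x) {n : ℕ}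
    (h : Module.InjDimLT (R ⧸ Ideal.span {x}) (R ⧸ Ideal.span {x}) (n + 1)) :
    Module.InjDimLT R R (n + 2) := by
  have hQ : Module.InjDimLT R (R ⧸ Ideal.span {x}) (n + 2) := of_quotient_span_singleton hx h
  have hex : Function.Exact (LinearMap.lsmul R R x) (Ideal.span {x}).mkQ := fun r ↦ by
    rw [Submodule.mkQ_apply, Submodule.Quotient.mk_eq_zero, Ideal.mem_span_singleton]
    exact ⟨fun ⟨t, ht⟩ ↦ ⟨t, ht.symm⟩, fun ⟨t, ht⟩ ↦ ⟨t, ht.symm⟩⟩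
  have hS := shortExact (f := LinearMap.lsmul R R x) hx hex (Submodule.mkQ_surjective _)
  refine of_subsingleton_ext fun I ↦ subsingleton_ext_of_smul_surjective hxm fun e ↦ ?_
  obtain ⟨e', he'⟩ := Ext.covariant_sequence_exact₂ _ hS e (hQ.subsingleton_ext.elim _ _)
  refine ⟨e', ?_⟩
  rw [← he', Ext.smul_eq_comp_mk₀]
  rfl

/-- Over a local ring of depth zero, finite injective dimension implies self-injectivity. -/
theorem Module.InjDimLT.one_of_depth_zero {z : R} (hz : z ≠ 0) (hmz : ∀ y ∈ maximalIdeal R, y * z = 0)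
    {n : ℕ} (h : Module.InjDimLT R R (n + 1)) : Module.InjDimLT R R 1 := by
  induction n with
  | zero => exact h
  | succ n ih =>
    refine ih (of_subsingleton_ext ?_)
    by_contra hne
    obtain ⟨I, hI, hmax⟩ := set_has_maximal_iff_noetherian.2 (inferInstanceAs (IsNoetherian R R))
      {I : Ideal R | ¬ Subsingleton (Ext (ModuleCat.of R (R ⧸ I)) (ModuleCat.of R R) (n + 1))}
      (not_forall.1 hne)
    have hmax' : ∀ J, I ≤ J → J ≠ I →
        Subsingleton (Ext (ModuleCat.of R (R ⧸ J)) (ModuleCat.of R R) (n + 1)) := fun J hJ hJI ↦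
      not_not.1 fun hJ' ↦ hmax J hJ' (lt_of_le_of_ne hJ hJI.symm)
    apply hI
    have hIm : I ≤ maximalIdeal R := by
      refine le_maximalIdeal fun hI1 ↦ hI (subsingleton_of_forall_eq 0 fun e ↦ ?_)
      have : Subsingleton (R ⧸ I) := Submodule.Quotient.subsingleton_iff.2 hI1
      rw [← Ext.mk₀_id_comp e, (ModuleCat.isZero_of_subsingleton (ModuleCat.of R (R ⧸ I))).eq_of_src
        (𝟙 _) 0, Ext.mk₀_zero, Ext.zero_comp]
    by_cases hy : ∃ y ∈ maximalIdeal R, y ∉ I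
    · obtain ⟨y, hym, hyI⟩ := hy
      let K : Ideal R := Submodule.comap (LinearMap.lsmul R R y) I
      have hIK : I ≤ K := fun r hr ↦ I.smul_mem y hr
      let f : (R ⧸ K) →ₗ[R] R ⧸ I := Submodule.mapQ K I (LinearMap.lsmul R R y) le_rfl
      let g : (R ⧸ I) →ₗ[R] R ⧸ (I ⊔ Ideal.span {y}) := Submodule.factor le_sup_left
      have hf : Function.Injective f := by
        rw [injective_iff_map_eq_zero]
        intro r hr
        obtain ⟨r, rfl⟩ := K.mkQ_surjective r
        rw [Submodule.mkQ_apply, Submodule.mapQ_apply, Submodule.Quotient.mk_eq_zero] at hr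
        rw [Submodule.mkQ_apply, Submodule.Quotient.mk_eq_zero]
        exact hr
      have hfg : Function.Exact f g := by
        intro r
        obtain ⟨r, rfl⟩ := I.mkQ_surjective r
        change Submodule.Quotient.mk r = 0 ↔ _
        rw [Submodule.Quotient.mk_eq_zero, Submodule.mem_sup]
        constructor
        · rintro ⟨i, hi, w, hw, rfl⟩
          obtain ⟨t, rfl⟩ := Ideal.mem_span_singleton.1 hw
          refine ⟨Submodule.Quotient.mk t, ?_⟩
          rw [Submodule.mapQ_apply, Submodule.mkQ_apply, Submodule.Quotient.eq]
          simpa using hi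
        · rintro ⟨t, ht⟩
          obtain ⟨t, rfl⟩ := K.mkQ_surjective t
          rw [Submodule.mkQ_apply, Submodule.mapQ_apply, Submodule.mkQ_apply,
            Submodule.Quotient.eq] at ht
          refine ⟨_, I.neg_mem ht, _, Ideal.mem_span_singleton.2 ⟨t, rfl⟩, ?_⟩
          simp
      have hS := shortExact hf hfg (Submodule.factor_surjective le_sup_left)
      by_cases hKI : K = I
      · refine subsingleton_ext_of_smul_surjective hym fun e ↦ ?_
        let φ : (R ⧸ I) →ₗ[R] R ⧸ I := y • LinearMap.id
        have hφ : Function.Injective φ := by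
          rw [injective_iff_map_eq_zero]
          intro r hr
          obtain ⟨r, rfl⟩ := I.mkQ_surjective r
          change Submodule.Quotient.mk (y • r) = 0 at hr
          rw [Submodule.Quotient.mk_eq_zero] at hr
          rw [Submodule.mkQ_apply, Submodule.Quotient.mk_eq_zero]
          exact hKI.le hr
        obtain ⟨e', he'⟩ := Ext.contravariant_sequence_exact₁
          (shortExact hφ φ.exact_map_mkQ_range (Submodule.mkQ_surjective _)) _ e
          (Nat.add_comm 1 (n + 1)) (h.subsingleton_ext.elim _ _)
        refine ⟨e', ?_⟩
        rw [← he']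
        change _ = (Ext.mk₀ (y • 𝟙 (ModuleCat.of R (R ⧸ I)))).comp e' (zero_add _)
        rw [Ext.mk₀_smul, Ext.smul_comp, Ext.mk₀_id_comp]
      · refine subsingleton_of_forall_eq 0 fun e ↦ ?_
        obtain ⟨e', rfl⟩ := Ext.contravariant_sequence_exact₂ hS _ e ((hmax' K hIK hKI).elim _ _)
        have : e' = 0 := (hmax' _ le_sup_left fun h ↦ hyI (h ▸ Ideal.mem_sup_right
          (Ideal.mem_span_singleton_self y))).elim _ _
        rw [this, Ext.comp_zero]
    · push Not at hy
      let f : (R ⧸ I) →ₗ[R] R :=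
        I.liftQ (LinearMap.toSpanSingleton R R z) fun r hr ↦ hmz r (hIm hr)
      have hf : Function.Injective f := by
        rw [injective_iff_map_eq_zero]
        intro r hr
        obtain ⟨r, rfl⟩ := I.mkQ_surjective r
        rw [Submodule.mkQ_apply, Submodule.Quotient.mk_eq_zero]
        refine hy r fun hu ↦ hz ?_
        exact hu.mul_right_eq_zero.1 hr
      refine subsingleton_of_forall_eq 0 fun e ↦ ?_
      obtain ⟨e', rfl⟩ := Ext.contravariant_sequence_exact₁
          (shortExact hf f.exact_map_mkQ_range (Submodule.mkQ_surjective _)) _ e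
          (Nat.add_comm 1 (n + 1)) (h.subsingleton_ext.elim _ _)
      have : e' = 0 := e'.eq_zero_of_projective
      rw [this, Ext.comp_zero]

end

section

variable {R : Type*} [CommRing R] [IsLocalRing R]

theorem IsLocalRing.quotient_of_ne_top {I : Ideal R} (hI : I ≠ ⊤) : IsLocalRing (R ⧸ I) :=
  have := Ideal.Quotient.nontrivial_iff.2 hI
  of_surjective' _ Ideal.Quotient.mk_surjective

theorem IsLocalRing.comap_mk_maximalIdeal (I : Ideal R) [IsLocalRing (R ⧸ I)] :
    (maximalIdeal (R ⧸ I)).comap (Ideal.Quotient.mk I) = maximalIdeal R :=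
  eq_maximalIdeal (Ideal.comap_isMaximal_of_surjective _ Ideal.Quotient.mk_surjective)

theorem IsLocalRing.mk_mem_maximalIdeal_iff {I : Ideal R} [IsLocalRing (R ⧸ I)] {r : R} :
    Ideal.Quotient.mk I r ∈ maximalIdeal (R ⧸ I) ↔ r ∈ maximalIdeal R := by
  rw [← Ideal.mem_comap, comap_mk_maximalIdeal]

theorem IsLocalRing.radical_comap_mk_eq_maximalIdeal_iff {I : Ideal R} [IsLocalRing (R ⧸ I)]
    {b : Ideal (R ⧸ I)} :
    (b.comap (Ideal.Quotient.mk I)).radical = maximalIdeal R ↔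
      b.radical = maximalIdeal (R ⧸ I) := by
  rw [← Ideal.comap_radical, ← comap_mk_maximalIdeal I]
  exact (Ideal.comap_injective_of_surjective _ Ideal.Quotient.mk_surjective).eq_iff

theorem span_singleton_ne_top_of_mem_maximalIdeal {x : R} (hx : x ∈ maximalIdeal R) :
    Ideal.span {x} ≠ ⊤ :=
  fun h ↦ (mem_maximalIdeal x).1 hx (Ideal.span_singleton_eq_top.1 h)

theorem IsParameterIdeal.le_maximalIdeal {b : Ideal R} (hb : IsParameterIdeal R b) :
    b ≤ maximalIdeal R := by
  obtain ⟨d, a, -, -, -, h⟩ := hb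
  exact h ▸ Ideal.le_radical

theorem IsParameterIdeal.radical {b : Ideal R} (hb : IsParameterIdeal R b) :
    b.radical = maximalIdeal R := by
  obtain ⟨d, a, -, -, -, h⟩ := hb
  exact h

theorem maximalIdeal_mem_minimalPrimes {I : Ideal R} (hI : I.radical = maximalIdeal R) :
    maximalIdeal R ∈ I.minimalPrimes :=
  ⟨⟨inferInstance, hI ▸ Ideal.le_radical⟩, fun _ hq _ ↦ hI ▸ (hq.1.radical_le_iff.2 hq.2)⟩

theorem IsParameterIdeal.comap_mk {x : R} (hx : x ∈ maximalIdeal R)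
    [IsLocalRing (R ⧸ Ideal.span {x})]
    (hdim : ringKrullDim R = ringKrullDim (R ⧸ Ideal.span {x}) + 1)
    {b : Ideal (R ⧸ Ideal.span {x})} (hb : IsParameterIdeal _ b) :
    IsParameterIdeal R (b.comap (Ideal.Quotient.mk (Ideal.span {x}))) := by
  obtain ⟨d, a, hd, ha, rfl, hrad⟩ := hb
  choose a' ha' using fun i ↦ Ideal.Quotient.mk_surjective (a i)
  refine ⟨d + 1, Fin.cons x a', by rw [hdim, hd]; rfl, fun i ↦ ?_, ?_,
    radical_comap_mk_eq_maximalIdeal_iff.2 hrad⟩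
  · refine Fin.cases hx (fun i ↦ ?_) i
    rw [Fin.cons_succ, ← mk_mem_maximalIdeal_iff (I := Ideal.span {x}), ha']
    exact ha i
  · have : Set.range a = Ideal.Quotient.mk (Ideal.span {x}) '' Set.range a' := by
      rw [← Set.range_comp]
      exact congrArg _ (funext fun i ↦ (ha' i).symm)
    rw [this, ← Ideal.map_span, Ideal.comap_map_of_surjective' _ Ideal.Quotient.mk_surjective,
      Ideal.mk_ker, Fin.range_cons, Ideal.span_insert, sup_comm]

variable [IsNoetherianRing R]

variable (R) in
theorem exists_ringKrullDim_eq_natCast : ∃ d : ℕ, ringKrullDim R = d := by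
  have h1 : ringKrullDim R ≠ ⊥ := ringKrullDim_ne_bot
  have h2 : ringKrullDim R ≠ ⊤ := ringKrullDim_ne_top
  obtain ⟨e, he⟩ := WithBot.ne_bot_iff_exists.1 h1
  rw [← he] at h2 ⊢
  obtain ⟨d, rfl⟩ := ENat.ne_top_iff_exists.1 (fun h : e = ⊤ ↦ h2 (by rw [h]; rfl))
  exact ⟨d, rfl⟩

theorem ringKrullDim_le_of_radical_span {d : ℕ} {a : Fin d → R}
    (h : (Ideal.span (Set.range a)).radical = maximalIdeal R) : ringKrullDim R ≤ d := by
  rw [← maximalIdeal_height_eq_ringKrullDim]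
  have h1 := Ideal.height_le_card_of_mem_minimalPrimes_span (Set.finite_range a)
    (maximalIdeal_mem_minimalPrimes h)
  have h2 : (Set.range a).ncard ≤ d := by
    rw [← Set.image_univ]
    exact (Set.ncard_image_le Set.finite_univ).trans (by simp)
  exact_mod_cast h1.trans (by exact_mod_cast h2)

theorem ringKrullDim_le_quotient_span_singleton_add_one {x : R} (hx : x ∈ maximalIdeal R) :
    ringKrullDim R ≤ ringKrullDim (R ⧸ Ideal.span {x}) + 1 := by
  have := ringKrullDim_le_ringKrullDim_quotient_add_card {x} (by
    simpa [IsLocalRing.ringJacobson_eq_maximalIdeal] using hx)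
  rwa [Finset.coe_singleton, Finset.card_singleton, Nat.cast_one] at this

variable (R) in
theorem exists_isParameterIdeal : ∃ b, IsParameterIdeal R b := by
  obtain ⟨s, hs, hcard⟩ :=
    Ideal.exists_finset_card_eq_height_of_isNoetherianRing (maximalIdeal R)
  refine ⟨Ideal.span s, s.card, fun i ↦ s.equivFin.symm i, ?_, fun i ↦ ?_, ?_, ?_⟩
  · rw [← maximalIdeal_height_eq_ringKrullDim, ← hcard]; rfl
  · exact hs.1.2 (Ideal.subset_span (s.equivFin.symm i).2)
  · congr 1
    ext x
    constructor
    · intro hx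
      exact ⟨s.equivFin ⟨x, hx⟩, by simp⟩
    · rintro ⟨i, rfl⟩
      exact (s.equivFin.symm i).2
  · refine le_antisymm (hs.1.1.radical_le_iff.2 hs.1.2) ?_
    rw [Ideal.radical_eq_sInf]
    refine le_sInf fun q ⟨hq1, hq2⟩ ↦ hs.2 ⟨hq2, hq1⟩ (IsLocalRing.le_maximalIdeal hq2.ne_top)

theorem ringKrullDim_quotient_parameter {d : ℕ} {a : Fin (d + 1) → R}
    (hd : ringKrullDim R = (d + 1 : ℕ)) (ha : ∀ i, a i ∈ maximalIdeal R)
    (hrad : (Ideal.span (Set.range a)).radical = maximalIdeal R)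
    [IsLocalRing (R ⧸ Ideal.span {a 0})] :
    ringKrullDim (R ⧸ Ideal.span {a 0}) = d ∧
      IsParameterIdeal (R ⧸ Ideal.span {a 0})
        ((Ideal.span (Set.range a)).map (Ideal.Quotient.mk (Ideal.span {a 0}))) := by
  set x := a 0
  have hmap : (Ideal.span (Set.range a)).map (Ideal.Quotient.mk (Ideal.span {x})) =
      Ideal.span (Set.range fun i : Fin d ↦ Ideal.Quotient.mk (Ideal.span {x}) (a i.succ)) := by
    rw [Ideal.map_span, ← Set.range_comp]
    apply le_antisymm
    · rw [Ideal.span_le]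
      rintro _ ⟨i, rfl⟩
      refine Fin.cases ?_ (fun i ↦ ?_) i
      · rw [Function.comp_apply,
          Ideal.Quotient.eq_zero_iff_mem.2 (Ideal.mem_span_singleton_self x)]
        exact Submodule.zero_mem _
      · exact Ideal.subset_span ⟨i, rfl⟩
    · refine Ideal.span_mono ?_
      rintro _ ⟨i, rfl⟩
      exact ⟨i.succ, rfl⟩
  have hrad' : ((Ideal.span (Set.range a)).map (Ideal.Quotient.mk (Ideal.span {x}))).radical =
      maximalIdeal _ := by
    rw [← radical_comap_mk_eq_maximalIdeal_iff, Ideal.comap_map_mk, hrad]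
    rw [Ideal.span_singleton_le_iff_mem]
    exact Ideal.subset_span ⟨0, rfl⟩
  have hdim : ringKrullDim (R ⧸ Ideal.span {x}) = d := by
    have h1 := ringKrullDim_le_quotient_span_singleton_add_one (ha 0)
    have h2 := ringKrullDim_le_of_radical_span (hmap ▸ hrad')
    change _ ≤ ringKrullDim (R ⧸ Ideal.span {x}) + 1 at h1
    obtain ⟨e, he⟩ := exists_ringKrullDim_eq_natCast (R ⧸ Ideal.span {x})
    rw [hd, he] at h1
    rw [he] at h2 ⊢
    norm_cast at h1 h2 ⊢
    lia
  exact ⟨hdim, d, _, hdim, fun i ↦ mk_mem_maximalIdeal_iff.2 (ha _), hmap, hrad'⟩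

end

section

variable {R : Type*} [CommRing R] [IsNoetherianRing R]

theorem exists_isPrime_annihilator {z : R} (hz : z ≠ 0) :
    ∃ p : Ideal R, p.IsPrime ∧ (∃ w, ∀ r, r ∈ p ↔ r * w = 0) ∧ ∀ r, r * z = 0 → r ∈ p := by
  obtain ⟨p, hp, hzp⟩ := exists_le_isAssociatedPrime_of_isNoetherianRing R z hz
  obtain ⟨hprime, w, rfl⟩ := (isAssociatedPrime_iff).1 hp
  exact ⟨_, hprime, ⟨w, fun r ↦ by simp [Submodule.mem_colon_singleton]⟩, fun r hr ↦ hzp <| by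
    simpa [Submodule.mem_colon_singleton] using hr⟩

theorem Ideal.exists_isSMulRegular_or_exists_annihilated (I : Ideal R) :
    (∃ x ∈ I, IsSMulRegular R x) ∨ ∃ z ≠ 0, ∀ y ∈ I, y * z = 0 := by
  by_cases! h : ∃ x ∈ I, IsSMulRegular R x
  · exact .inl h
  right
  have hI : (I : Set R) ⊆ ⋃ p ∈ associatedPrimes R R, (p : Set R) := by
    rw [biUnion_associatedPrimes_eq_compl_regular]
    exact h
  obtain ⟨p, hp, hIp⟩ := (Ideal.subset_union_prime_finite (associatedPrimes.finite R R)
    ⊥ ⊥ (fun p hp _ _ ↦ hp.1)).1 hI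
  obtain ⟨hprime, w, rfl⟩ := (isAssociatedPrime_iff).1 hp
  refine ⟨w, ?_, fun y hy ↦ by simpa [Submodule.mem_colon_singleton] using hIp hy⟩
  rintro rfl
  exact hprime.ne_top (by simp)

theorem exists_ne_zero_maximalIdeal_mul_eq_zero [IsLocalRing R] {I : Ideal R}
    (hI : I.radical = maximalIdeal R) {z : R} (hz : z ≠ 0) (hIz : ∀ y ∈ I, y * z = 0) :
    ∃ w : R, w ≠ 0 ∧ ∀ y ∈ maximalIdeal R, y * w = 0 := by
  obtain ⟨p, hp, ⟨w, hw⟩, h⟩ := exists_isPrime_annihilator hz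
  refine ⟨w, ?_, fun y hy ↦ (hw y).1 ?_⟩
  · rintro rfl
    exact hp.ne_top ((Ideal.eq_top_iff_one p).2 ((hw 1).2 (mul_zero 1)))
  · exact hp.radical_le_iff.2 (fun y hy ↦ h y (hIz y hy)) (hI.symm ▸ hy)

end

theorem Module.Injective.exists_apply_eq {R Q N : Type u} [CommRing R] [AddCommGroup Q] [Module R Q]
    [AddCommGroup N] [Module R N] (hQ : Module.Injective R Q) {y : N} {z : Q}
    (h : ∀ r : R, r • y = 0 → r • z = 0) : ∃ f : N →ₗ[R] Q, f y = z := by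
  let t := LinearMap.toSpanSingleton R N y
  obtain ⟨f, hf⟩ := hQ.extension_property _ _ _ _ (t.ker.liftQ t le_rfl)
    (LinearMap.ker_eq_bot.1 (t.ker.ker_liftQ_eq_bot _ _ le_rfl))
    (t.ker.liftQ (LinearMap.toSpanSingleton R Q z) h)
  have h1 := LinearMap.congr_fun hf (Submodule.Quotient.mk 1)
  change f ((1 : R) • y) = (1 : R) • z at h1
  rw [one_smul, one_smul] at h1
  exact ⟨f, h1⟩

theorem Module.Injective.exists_eq_mul {R : Type u} [CommRing R] (hR : Module.Injective R R)
    {y z : R} (h : ∀ r, r * y = 0 → r * z = 0) : ∃ c, z = y * c := by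
  obtain ⟨f, hf⟩ := hR.exists_apply_eq h
  exact ⟨f 1, by rw [← hf, ← smul_eq_mul, ← map_smul, smul_eq_mul, mul_one]⟩

theorem Module.Injective.pow_eq_zero {R : Type u} [CommRing R] [IsNoetherianRing R]
    [IsLocalRing R] (hR : Module.Injective R R) {y : R} (hy : y ∈ maximalIdeal R) :
    ∃ n, y ^ n = 0 := by
  obtain ⟨n, hn⟩ := monotone_stabilizes_iff_noetherian.2 (inferInstanceAs (IsNoetherian R R))
    ⟨fun n ↦ (LinearMap.toSpanSingleton R R (y ^ n)).ker, monotone_nat_of_le_succ fun n r hr ↦ by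
      have hr' : r * y ^ n = 0 := hr
      change r * y ^ (n + 1) = 0
      rw [pow_succ, ← mul_assoc, hr', zero_mul]⟩
  refine ⟨n, ?_⟩
  obtain ⟨c, hc⟩ := hR.exists_eq_mul (y := y ^ (n + 1)) (z := y ^ n)
    fun r hr ↦ (hn (n + 1) n.le_succ).ge (x := r) hr
  have hu : IsUnit (1 - y * c) := by
    by_contra hu
    have := Ideal.add_mem _ ((mem_maximalIdeal _).2 hu) (Ideal.mul_mem_right c _ hy)
    rw [sub_add_cancel] at this
    exact (mem_maximalIdeal _).1 this isUnit_one
  refine hu.mul_left_eq_zero.1 ?_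
  rw [mul_sub, mul_one, ← mul_assoc, ← pow_succ, ← hc, sub_self]

theorem Module.Injective.ringKrullDim_eq_zero {R : Type u} [CommRing R] [IsNoetherianRing R]
    [IsLocalRing R] (hR : Module.Injective R R) : ringKrullDim R = 0 := by
  refine le_antisymm ?_ ringKrullDim_nonneg_of_nontrivial
  refine ringKrullDim_le_of_radical_span (a := (Fin.elim0 : Fin 0 → R)) ?_
  refine le_antisymm (IsLocalRing.le_maximalIdeal ?_) fun y hy ↦ ?_
  · simp [Ideal.radical_eq_top]
  · obtain ⟨n, hn⟩ := hR.pow_eq_zero hy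
    exact ⟨n, by rw [hn]; exact Submodule.zero_mem _⟩

theorem ringKrullDim_quotient_of_isPrime_annihilator {R : Type u} [CommRing R]
    [IsNoetherianRing R] [IsLocalRing R] {n : ℕ} (h : Module.InjDimLT R R (n + 1))
    {p : Ideal R} (hp : p.IsPrime) {w : R} (hw : ∀ r, r ∈ p ↔ r * w = 0) :
    ringKrullDim R ≤ ringKrullDim (R ⧸ p) := by
  obtain ⟨d, hd⟩ := exists_ringKrullDim_eq_natCast R
  induction d generalizing R n with
  | zero => exact hd.trans_le ringKrullDim_nonneg_of_nontrivial
  | succ d ih =>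
    obtain ⟨y, hym, hy⟩ | ⟨z, hz, hmz⟩ :=
      (maximalIdeal R).exists_isSMulRegular_or_exists_annihilated
    swap
    · have := (Module.InjDimLT.one_iff.1 (h.one_of_depth_zero hz hmz)).ringKrullDim_eq_zero
      rw [hd] at this
      norm_cast at this
    have hw0 : w ≠ 0 := by
      rintro rfl
      exact hp.ne_top ((Ideal.eq_top_iff_one p).2 ((hw 1).2 (mul_zero 1)))
    have hy0 {r : R} (hr : y * r = 0) : r = 0 := hy (hr.trans (mul_zero y).symm)
    obtain ⟨w', hw', hw'y⟩ : ∃ w', (∀ r, r ∈ p ↔ r * w' = 0) ∧ w' ∉ Ideal.span {y} := by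
      by_contra! hcon
      have key : ∀ k : ℕ, ∃ w', w = y ^ k * w' := by
        intro k
        induction k with
        | zero => exact ⟨w, by simp⟩
        | succ k ihk =>
          obtain ⟨w', hw'⟩ := ihk
          have : w' ∈ Ideal.span {y} := hcon w' fun r ↦ by
            rw [hw, hw', mul_left_comm]
            refine ⟨fun h ↦ ?_, fun h ↦ by rw [h, mul_zero]⟩
            have := hy.pow k (h.trans (mul_zero (y ^ k)).symm : y ^ k • (r * w') = y ^ k • 0)
            exact this
          obtain ⟨t, rfl⟩ := Ideal.mem_span_singleton.1 this
          exact ⟨t, by rw [hw', pow_succ, mul_assoc]⟩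
      have hbot := Ideal.iInf_pow_eq_bot_of_isLocalRing (Ideal.span {y})
        (span_singleton_ne_top_of_mem_maximalIdeal hym)
      refine hw0 ((Ideal.mem_bot (R := R)).1 (hbot.le ((Submodule.mem_iInf _).2 fun k ↦ ?_)))
      obtain ⟨w', hw'⟩ := key k
      rw [Ideal.span_singleton_pow, Ideal.mem_span_singleton]
      exact ⟨w', hw'⟩
    have := quotient_of_ne_top (span_singleton_ne_top_of_mem_maximalIdeal hym)
    have hdim := ringKrullDim_quotient_span_singleton_succ_eq_ringKrullDim hy hym
    have hS : Module.InjDimLT (R ⧸ Ideal.span {y}) (R ⧸ Ideal.span {y}) (n + 1) :=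
      Module.InjDimLT.quotient_span_singleton hy (h.mono (Nat.le_succ _))
    obtain ⟨q, hq, ⟨v, hv⟩, hqw⟩ := exists_isPrime_annihilator
      (z := Ideal.Quotient.mk (Ideal.span {y}) w') (by rwa [Ne, Ideal.Quotient.eq_zero_iff_mem])
    have hdS : ringKrullDim (R ⧸ Ideal.span {y}) = d := by
      obtain ⟨e, he⟩ := exists_ringKrullDim_eq_natCast (R ⧸ Ideal.span {y})
      rw [he, hd] at hdim
      rw [he]
      norm_cast at hdim ⊢
      lia
    have ihq := ih hS hq hv hdS
    have hpq : p ≤ q.comap (Ideal.Quotient.mk (Ideal.span {y})) := fun r hr ↦ hqw _ <| by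
      rw [← map_mul, (hw' r).1 hr, map_zero]
    have hyp : Ideal.Quotient.mk p y ∈ nonZeroDivisors (R ⧸ p) := by
      rw [mem_nonZeroDivisors_iff_ne_zero, Ne, Ideal.Quotient.eq_zero_iff_mem, hw]
      exact fun h ↦ hw0 (hy0 h)
    let φ : (R ⧸ p) ⧸ Ideal.span {Ideal.Quotient.mk p y} →+* (R ⧸ Ideal.span {y}) ⧸ q :=
      Ideal.Quotient.lift _ (Ideal.quotientMap q (Ideal.Quotient.mk (Ideal.span {y})) hpq) <| by
        intro a ha
        obtain ⟨t, rfl⟩ := Ideal.mem_span_singleton.1 ha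
        rw [map_mul, Ideal.quotientMap_mk,
          Ideal.Quotient.eq_zero_iff_mem.2 (Ideal.mem_span_singleton_self y), map_zero, zero_mul]
    have hφ : Function.Surjective φ := by
      apply Ideal.Quotient.lift_surjective_of_surjective
      exact Ideal.quotientMap_surjective Ideal.Quotient.mk_surjective
    rw [← hdim]
    refine le_trans ?_ (ringKrullDim_quotient_succ_le_of_nonZeroDivisor hyp)
    gcongr
    exact ihq.trans (ringKrullDim_le_of_surjective φ hφ)

theorem Module.Injective.self_of_ringEquiv {R S : Type u} [CommRing R] [CommRing S] (e : R ≃+* S)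
    (hR : Module.Injective R R) : Module.Injective S S :=
  have := RingHomInvPair.of_ringEquiv e
  have := RingHomInvPair.symm (e : R →+* S) (e.symm : S →+* R)
  Module.Injective.of_ringEquiv e
    ({ __ := e.toAddEquiv, map_smul' := fun r s ↦ map_mul e r s } : R ≃ₛₗ[(e : R →+* S)] S)

theorem IsParameterIdeal.injective_quotient {R : Type u} [CommRing R] [IsNoetherianRing R]
    [IsLocalRing R] {n : ℕ} (h : Module.InjDimLT R R (n + 1)) {b : Ideal R}
    (hb : IsParameterIdeal R b) : Module.Injective (R ⧸ b) (R ⧸ b) := by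
  obtain ⟨d, a, hd, ha, rfl, hrad⟩ := hb
  induction d generalizing R n with
  | zero =>
    have hbot : Ideal.span (Set.range a) = ⊥ := by simp [Set.range_eq_empty]
    rw [hbot] at hrad ⊢
    obtain ⟨z, hz, hmz⟩ := exists_ne_zero_maximalIdeal_mul_eq_zero hrad (one_ne_zero (α := R))
      (by simp)
    exact (Module.InjDimLT.one_iff.1 (h.one_of_depth_zero hz hmz)).self_of_ringEquiv
      (RingEquiv.quotientBot R).symm
  | succ d ih =>
    have := quotient_of_ne_top (span_singleton_ne_top_of_mem_maximalIdeal (ha 0))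
    obtain ⟨hdim, d', a', hd', ha', hspan, hrad'⟩ := ringKrullDim_quotient_parameter hd ha hrad
    obtain rfl : d' = d := by
      rw [hdim] at hd'
      exact_mod_cast hd'.symm
    have hreg : IsSMulRegular R (a 0) := by
      rw [isSMulRegular_iff_right_eq_zero_of_smul]
      intro z hz
      by_contra hz0
      obtain ⟨p, hp, ⟨w, hw⟩, hzp⟩ := exists_isPrime_annihilator hz0
      have h1 := ringKrullDim_quotient_of_isPrime_annihilator h hp hw
      have h2 : Ideal.span {a 0} ≤ p := (Ideal.span_singleton_le_iff_mem _).2 (hzp _ hz)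
      have h3 := ringKrullDim_le_of_surjective _ (Ideal.Quotient.factor_surjective h2)
      have h4 := h1.trans h3
      rw [hd, hdim] at h4
      norm_cast at h4
      lia
    have hS : Module.InjDimLT (R ⧸ Ideal.span {a 0}) (R ⧸ Ideal.span {a 0}) (n + 1) :=
      Module.InjDimLT.quotient_span_singleton hreg (h.mono (Nat.le_succ _))
    have key := ih hS a' hd' ha' (hspan ▸ hrad')
    rw [← hspan] at key
    refine key.self_of_ringEquiv (DoubleQuot.quotQuotEquivQuotOfLE ?_)
    rw [Ideal.span_singleton_le_iff_mem]
    exact Ideal.subset_span ⟨0, rfl⟩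

section

variable {R : Type*} [CommRing R]

theorem nonempty_hom_quotient_equiv_iff {a b : Ideal R} :
    Nonempty (((R ⧸ a) →ₗ[R] (R ⧸ b)) ≃ₗ[R] (R ⧸ a)) ↔
      ∃ c, (∀ r, r * c ∈ b ↔ r ∈ a) ∧
        ∀ z, (∀ r ∈ a, r * z ∈ b) → ∃ α, z - α * c ∈ b := by
  constructor
  · rintro ⟨e⟩
    obtain ⟨c, hc⟩ := b.mkQ_surjective (e.symm (a.mkQ 1) (a.mkQ 1))
    have key : ∀ r, (r • e.symm (a.mkQ 1)) (a.mkQ 1) = b.mkQ (r * c) := fun r ↦ by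
      rw [LinearMap.smul_apply, ← hc, ← map_smul, smul_eq_mul]
    refine ⟨c, fun r ↦ ?_, fun z hz ↦ ?_⟩
    · rw [← Submodule.Quotient.mk_eq_zero, ← Submodule.mkQ_apply, ← key]
      constructor
      · intro h
        have h1 : r • e.symm (a.mkQ 1) = 0 :=
          Submodule.linearMap_qext _ (LinearMap.ext_ring h)
        rw [← map_smul, LinearEquiv.map_eq_zero_iff, ← map_smul, smul_eq_mul, mul_one,
          Submodule.mkQ_apply, Submodule.Quotient.mk_eq_zero] at h1
        exact h1
      · intro h
        rw [LinearMap.smul_apply, ← map_smul, ← map_smul, smul_eq_mul, mul_one,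
          show a.mkQ r = 0 from (Submodule.Quotient.mk_eq_zero a).2 h, map_zero]
    · let ψ : (R ⧸ a) →ₗ[R] R ⧸ b := a.mapQ b (LinearMap.toSpanSingleton R R z) hz
      obtain ⟨α, hα⟩ := a.mkQ_surjective (e ψ)
      refine ⟨α, ?_⟩
      have h1 : ψ = α • e.symm (a.mkQ 1) := by
        rw [← map_smul, ← map_smul, smul_eq_mul, mul_one, hα, e.symm_apply_apply]
      have h2 := LinearMap.congr_fun h1 (a.mkQ 1)
      rw [key] at h2
      rw [← Submodule.Quotient.eq, ← Submodule.mkQ_apply, ← Submodule.mkQ_apply, ← h2]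
      change b.mkQ z = b.mkQ ((1 : R) • z)
      rw [one_smul]
  · rintro ⟨c, hc, hz⟩
    let φ : (R ⧸ a) →ₗ[R] R ⧸ b :=
      a.mapQ b (LinearMap.toSpanSingleton R R c) fun r hr ↦ (hc r).2 hr
    have hφ : ∀ r, (r • φ) (a.mkQ 1) = b.mkQ (r * c) := fun r ↦ by
      rw [LinearMap.smul_apply, ← map_smul, ← map_smul, smul_eq_mul, mul_one]
      rfl
    have hle : a ≤ (LinearMap.toSpanSingleton R _ φ).ker := fun r hr ↦ by
      refine Submodule.linearMap_qext _ (LinearMap.ext_ring ((hφ r).trans ?_))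
      exact (Submodule.Quotient.mk_eq_zero b).2 ((hc r).2 hr)
    refine ⟨(LinearEquiv.ofBijective (a.liftQ (LinearMap.toSpanSingleton R _ φ) hle)
      ⟨?_, fun ψ ↦ ?_⟩).symm⟩
    · rw [injective_iff_map_eq_zero]
      intro r hr
      obtain ⟨r, rfl⟩ := a.mkQ_surjective r
      have h1 : r • φ = 0 := hr
      have h2 := hφ r
      rw [h1, LinearMap.zero_apply, eq_comm, Submodule.mkQ_apply,
        Submodule.Quotient.mk_eq_zero] at h2
      exact (Submodule.Quotient.mk_eq_zero a).2 ((hc r).1 h2)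
    · obtain ⟨z, hz'⟩ := b.mkQ_surjective (ψ (a.mkQ 1))
      obtain ⟨α, hα⟩ := hz z fun r hr ↦ by
        rw [← Submodule.Quotient.mk_eq_zero, ← smul_eq_mul, ← Submodule.mkQ_apply, map_smul, hz',
          ← map_smul, ← map_smul, smul_eq_mul, mul_one, Submodule.mkQ_apply,
          (Submodule.Quotient.mk_eq_zero a).2 hr, map_zero]
      refine ⟨a.mkQ α, Submodule.linearMap_qext _ (LinearMap.ext_ring ?_)⟩
      change (α • φ) (a.mkQ 1) = ψ (a.mkQ 1)
      rw [hφ, ← hz', eq_comm]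
      exact (Submodule.Quotient.eq b).2 hα

end

theorem Module.Injective.exists_socle_generator {R : Type u} [CommRing R] [IsNoetherianRing R]
    [IsLocalRing R] {a : Ideal R} (hrad : a.radical = maximalIdeal R)
    (h : Module.Injective (R ⧸ a) (R ⧸ a)) :
    ∃ s ∉ a, (∀ u ∈ maximalIdeal R, u * s ∈ a) ∧ ∀ r ∉ a, ∃ v, s - r * v ∈ a := by
  have ha : a ≠ ⊤ := fun h ↦ (maximalIdeal.isMaximal R).ne_top <| by
    rw [← hrad, h, Ideal.radical_top]
  have := quotient_of_ne_top ha
  have hbot : (⊥ : Ideal (R ⧸ a)).radical = maximalIdeal (R ⧸ a) := by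
    rw [← radical_comap_mk_eq_maximalIdeal_iff, ← RingHom.ker_eq_comap_bot, Ideal.mk_ker, hrad]
  obtain ⟨s, hs, hms⟩ := exists_ne_zero_maximalIdeal_mul_eq_zero hbot
    (one_ne_zero (α := R ⧸ a)) (by simp)
  obtain ⟨s, rfl⟩ := Ideal.Quotient.mk_surjective s
  refine ⟨s, fun h ↦ hs (Ideal.Quotient.eq_zero_iff_mem.2 h), fun u hu ↦ ?_, fun r hr ↦ ?_⟩
  · rw [← Ideal.Quotient.eq_zero_iff_mem, map_mul]
    exact hms _ (mk_mem_maximalIdeal_iff.2 hu)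
  · obtain ⟨v, hv⟩ := h.exists_eq_mul (y := Ideal.Quotient.mk a r) (z := Ideal.Quotient.mk a s)
      fun q hq ↦ hms q fun hu ↦ hr <| by
        rw [← Ideal.Quotient.eq_zero_iff_mem]
        exact hu.mul_right_eq_zero.1 hq
    obtain ⟨v, rfl⟩ := Ideal.Quotient.mk_surjective v
    exact ⟨v, by rw [← Ideal.Quotient.eq_zero_iff_mem, map_sub, map_mul, hv, sub_self]⟩

theorem Module.Injective.exists_mul_mem_iff {R : Type u} [CommRing R] [IsNoetherianRing R]
    [IsLocalRing R] {a b : Ideal R} (hba : b ≤ a) (hra : a.radical = maximalIdeal R)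
    (hrb : b.radical = maximalIdeal R) (ha : Module.Injective (R ⧸ a) (R ⧸ a))
    (hb : Module.Injective (R ⧸ b) (R ⧸ b)) : ∃ c, ∀ r, r * c ∈ b ↔ r ∈ a := by
  obtain ⟨s, hs, -, hsr⟩ := ha.exists_socle_generator hra
  obtain ⟨t, ht, hmt, -⟩ := hb.exists_socle_generator hrb
  let A := a.map (Ideal.Quotient.mk b)
  have hA : ∀ r, Ideal.Quotient.mk b r ∈ A ↔ r ∈ a := fun r ↦ by
    rw [← Ideal.mem_comap, Ideal.comap_map_mk hba]
  obtain ⟨f, hf⟩ := hb.exists_apply_eq (N := (R ⧸ b) ⧸ A)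
    (y := Submodule.Quotient.mk (Ideal.Quotient.mk b s)) (z := Ideal.Quotient.mk b t) <| by
      intro r hr
      obtain ⟨r, rfl⟩ := Ideal.Quotient.mk_surjective r
      rw [← Submodule.Quotient.mk_smul, Submodule.Quotient.mk_eq_zero, smul_eq_mul, ← map_mul,
        hA] at hr
      rw [smul_eq_mul, ← map_mul, Ideal.Quotient.eq_zero_iff_mem]
      refine hmt r fun hu ↦ hs ?_
      obtain ⟨u, rfl⟩ := hu
      simpa using a.mul_mem_left (↑u⁻¹) hr
  obtain ⟨c, hc⟩ := Ideal.Quotient.mk_surjective (f (Submodule.Quotient.mk 1))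
  have key : ∀ r, f (Submodule.Quotient.mk (Ideal.Quotient.mk b r)) = Ideal.Quotient.mk b (r * c) :=
    fun r ↦ by
      rw [map_mul, hc, ← smul_eq_mul, ← map_smul, ← Submodule.Quotient.mk_smul, smul_eq_mul, mul_one]
  refine ⟨c, fun r ↦ ⟨fun h ↦ ?_, fun h ↦ ?_⟩⟩
  · by_contra hr
    obtain ⟨v, hv⟩ := hsr r hr
    apply ht
    rw [← hA, map_sub, ← Submodule.Quotient.eq] at hv
    rw [hv, key] at hf
    rw [← Ideal.Quotient.eq_zero_iff_mem, ← hf, Ideal.Quotient.eq_zero_iff_mem, mul_right_comm]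
    exact b.mul_mem_right v h
  · rw [← Ideal.Quotient.eq_zero_iff_mem, ← key, (Submodule.Quotient.mk_eq_zero A).2 ((hA r).2 h),
      map_zero]

theorem nonempty_hom_quotient_equiv_of_injDimLT {R : Type u} [CommRing R] [IsNoetherianRing R]
    [IsLocalRing R] {n : ℕ} (h : Module.InjDimLT R R (n + 1)) {a b : Ideal R}
    (ha : IsParameterIdeal R a) (hb : IsParameterIdeal R b) (hba : b ≤ a) :
    Nonempty (((R ⧸ a) →ₗ[R] (R ⧸ b)) ≃ₗ[R] (R ⧸ a)) := by
  rw [nonempty_hom_quotient_equiv_iff]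
  have hb' := hb.injective_quotient h
  obtain ⟨c, hc⟩ := Module.Injective.exists_mul_mem_iff hba ha.radical hb.radical
    (ha.injective_quotient h) hb'
  refine ⟨c, hc, fun z hz ↦ ?_⟩
  obtain ⟨α, hα⟩ := hb'.exists_eq_mul (y := Ideal.Quotient.mk b c) (z := Ideal.Quotient.mk b z)
    fun r hr ↦ by
      obtain ⟨r, rfl⟩ := Ideal.Quotient.mk_surjective r
      rw [← map_mul, Ideal.Quotient.eq_zero_iff_mem] at hr ⊢
      exact hz r ((hc r).1 hr)
  obtain ⟨α, rfl⟩ := Ideal.Quotient.mk_surjective α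
  exact ⟨α, by rw [← Ideal.Quotient.eq_zero_iff_mem, map_sub, map_mul, hα, mul_comm, sub_self]⟩

theorem isIrreducibleIdeal_of_injective_quotient {R : Type u} [CommRing R] [IsNoetherianRing R]
    [IsLocalRing R] {a : Ideal R} (hrad : a.radical = maximalIdeal R)
    (h : Module.Injective (R ⧸ a) (R ⧸ a)) : IsIrreducibleIdeal a := by
  obtain ⟨s, hs, -, hsr⟩ := h.exists_socle_generator hrad
  refine ⟨fun h ↦ hs (h ▸ trivial), fun J K hJK ↦ ?_⟩
  have key : ∀ J, a ≤ J → a ≠ J → s ∈ J := fun J hJ hne ↦ by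
    obtain ⟨r, hrJ, hra⟩ := SetLike.exists_of_lt (lt_of_le_of_ne hJ hne)
    obtain ⟨v, hv⟩ := hsr r hra
    simpa using J.add_mem (hJ hv) (J.mul_mem_right v hrJ)
  by_contra! hcon
  exact hs (hJK ▸ ⟨key J (hJK ▸ inf_le_left) hcon.1, key K (hJK ▸ inf_le_right) hcon.2⟩)

section

variable {R : Type u} [CommRing R]

theorem LinearMap.length_ker_add_length_range {M N : Type*} [AddCommGroup M] [Module R M]
    [AddCommGroup N] [Module R N] (g : M →ₗ[R] N) :
    Module.length R g.ker + Module.length R g.range = Module.length R M :=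
  (Module.length_eq_add_of_exact g.ker.subtype g.rangeRestrict g.ker.subtype_injective
    g.surjective_rangeRestrict
    (by rw [LinearMap.exact_iff, LinearMap.ker_rangeRestrict, Submodule.range_subtype])).symm

theorem Submodule.length_add_length_quotient {M : Type*} [AddCommGroup M] [Module R M]
    (N : Submodule R M) :
    Module.length R N + Module.length R (M ⧸ N) = Module.length R M :=
  (Module.length_eq_add_of_exact N.subtype N.mkQ N.subtype_injective N.mkQ_surjective
    (LinearMap.exact_subtype_mkQ N)).symm

theorem length_ker_lcomp_subtype_le {M Q : Type*} [AddCommGroup M] [Module R M] [AddCommGroup Q]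
    [Module R Q] (N : Submodule R M) :
    Module.length R (LinearMap.lcomp R Q N.subtype).ker ≤ Module.length R (M ⧸ N →ₗ[R] Q) := by
  let f : (LinearMap.lcomp R Q N.subtype).ker →ₗ[R] (M ⧸ N →ₗ[R] Q) :=
    { toFun := fun φ ↦ N.liftQ φ.1 fun n hn ↦ LinearMap.congr_fun φ.2 ⟨n, hn⟩
      map_add' := fun _ _ ↦ Submodule.linearMap_qext _ rfl
      map_smul' := fun _ _ ↦ Submodule.linearMap_qext _ rfl }
  refine Module.length_le_of_injective f fun φ ψ h ↦ Subtype.ext (LinearMap.ext fun m ↦ ?_)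
  exact LinearMap.congr_fun h (N.mkQ m)

theorem length_hom_le_of_length_hom_simple_le {Q : Type*} [AddCommGroup Q] [Module R Q]
    (hQ : ∀ (S : Type u) [AddCommGroup S] [Module R S] [IsSimpleModule R S],
      Module.length R (S →ₗ[R] Q) ≤ 1) {M : Type u} [AddCommGroup M] [Module R M]
    (hM : IsFiniteLength R M) : Module.length R (M →ₗ[R] Q) ≤ Module.length R M := by
  induction hM with
  | of_subsingleton => simp
  | @of_simple_quotient M _ _ N _ _ ih =>
    rw [← (LinearMap.lcomp R Q N.subtype).length_ker_add_length_range,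
      ← N.length_add_length_quotient, add_comm, Module.length_eq_one (R := R) (M := M ⧸ N)]
    exact add_le_add ((Module.length_le_of_injective _ (Submodule.subtype_injective _)).trans ih)
      ((length_ker_lcomp_subtype_le N).trans (hQ _))

theorem Module.injective_self_of_length_hom_le [IsArtinianRing R]
    (h : ∀ (M : Type u) [AddCommGroup M] [Module R M], IsFiniteLength R M →
      Module.length R (M →ₗ[R] R) ≤ Module.length R M) : Module.Injective R R := by
  refine Module.Baer.injective (Module.Baer.iff_surjective.2 fun J ↦ ?_)
  let g : (R →ₗ[R] R) →ₗ[R] (J →ₗ[R] R) := LinearMap.lcomp R R J.subtype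
  change Function.Surjective g
  have hfin (M : Type u) [AddCommGroup M] [Module R M] [Module.Finite R M] :
      IsFiniteLength R M :=
    isFiniteLength_iff_isNoetherian_isArtinian.2 ⟨inferInstance, inferInstance⟩
  have hker : Module.length R g.ker ≤ Module.length R (R ⧸ J) :=
    (length_ker_lcomp_subtype_le J).trans (h (R ⧸ J) (hfin _))
  have h1 := g.length_ker_add_length_range
  have h2 := Submodule.length_add_length_quotient J
  rw [(LinearMap.ringLmapEquivSelf R R R).length_eq, ← h2, add_comm] at h1
  have hne : Module.length R (R ⧸ J) ≠ ⊤ := Module.length_ne_top_iff.2 (hfin _)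
  have h3 : Module.length R J ≤ Module.length R g.range := by
    refine (ENat.add_le_add_iff_right hne).1 ?_
    rw [← h1]
    gcongr
  have h4 := h J (hfin _)
  rw [← LinearMap.range_eq_top]
  by_contra hcon
  obtain ⟨_, _⟩ := isFiniteLength_iff_isNoetherian_isArtinian.1 (Module.length_ne_top_iff.1
    (ne_top_of_le_ne_top (Module.length_ne_top_iff.2 (hfin J)) h4))
  exact absurd (Submodule.length_lt hcon) (h4.trans h3).not_gt

theorem Module.injective_self_of_isIrreducibleIdeal_bot [IsNoetherianRing R] [IsLocalRing R]
    (hrad : (⊥ : Ideal R).radical = maximalIdeal R) (h : IsIrreducibleIdeal (⊥ : Ideal R)) :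
    Module.Injective R R := by
  have hart : IsArtinianRing R := by
    rw [isArtinianRing_iff_isNilpotent_maximalIdeal]
    obtain ⟨n, hn⟩ := (⊥ : Ideal R).exists_radical_pow_le_of_fg
      (IsNoetherian.noetherian _)
    exact ⟨n, by rw [← hrad]; exact le_bot_iff.1 hn⟩
  obtain ⟨s, hs, hms⟩ := exists_ne_zero_maximalIdeal_mul_eq_zero hrad
    (one_ne_zero (α := R)) (by simp)
  have key (z : R) (hmz : ∀ y ∈ maximalIdeal R, y * z = 0) : z ∈ Ideal.span {s} := by
    by_cases hz : z = 0
    · rw [hz]; exact zero_mem _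
    have hne : Ideal.span {z} ⊓ Ideal.span {s} ≠ ⊥ := fun hbot ↦ by
      rcases h.2 _ _ hbot.symm with h | h
      · exact hz (Ideal.span_singleton_eq_bot.1 h.symm)
      · exact hs (Ideal.span_singleton_eq_bot.1 h.symm)
    obtain ⟨y, ⟨hyz, hys⟩, hy⟩ := Submodule.exists_mem_ne_zero_of_ne_bot hne
    obtain ⟨α, rfl⟩ := Ideal.mem_span_singleton'.1 hyz
    have hα : IsUnit α := by
      by_contra hα
      exact hy (hmz α ((mem_maximalIdeal α).2 hα))
    exact (Ideal.unit_mul_mem_iff_mem _ hα).1 hys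
  refine Module.injective_self_of_length_hom_le fun M _ _ hM ↦
    length_hom_le_of_length_hom_simple_le (fun S _ _ _ ↦ ?_) hM
  have hmS (y : R) (hy : y ∈ maximalIdeal R) (v : S) : y • v = 0 := by
    rw [← eq_maximalIdeal (IsSimpleModule.annihilator_isMaximal (M := S))] at hy
    exact Module.mem_annihilator.1 hy v
  have := IsSimpleModule.nontrivial R S
  obtain ⟨v, hv⟩ := exists_ne (0 : S)
  have hvS : Submodule.span R {v} = ⊤ := (IsSimpleOrder.eq_bot_or_eq_top _).resolve_left
    (by simpa using hv)
  have hlen : Module.length R (Ideal.span {s}) ≤ 1 := by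
    have : IsSimpleModule R (R ⧸ maximalIdeal R) :=
      isSimpleModule_iff_isCoatom.2 (maximalIdeal.isMaximal R).out
    rw [← Module.length_eq_one (R := R) (M := R ⧸ maximalIdeal R)]
    refine Module.length_le_of_surjective ((maximalIdeal R).liftQ (LinearMap.toSpanSingleton R
      (Ideal.span {s}) ⟨s, Ideal.mem_span_singleton_self s⟩)
      fun y hy ↦ Subtype.ext (hms y hy)) ?_
    rintro ⟨t, ht⟩
    obtain ⟨r, rfl⟩ := Ideal.mem_span_singleton'.1 ht
    exact ⟨Submodule.Quotient.mk r, rfl⟩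
  refine le_trans ?_ hlen
  let f : (S →ₗ[R] R) →ₗ[R] Ideal.span {s} :=
    (LinearMap.applyₗ v).codRestrict (Ideal.span {s}) fun φ ↦ key _ fun y hy ↦ by
      change y * φ v = 0
      rw [← smul_eq_mul, ← map_smul, hmS y hy, map_zero]
  refine Module.length_le_of_injective f fun φ ψ h ↦ ?_
  refine LinearMap.ext_on_range (v := fun _ : Unit ↦ v) (by simpa using hvS) fun _ ↦ ?_
  exact congrArg Subtype.val h

end

/-- For parameter ideals `b ≤ a`, the ideal `b : a` is generated modulo `b` by an element `c`
with `b : c = a`; equivalently, `Hom(R/a, R/b) ≃ R/a`. -/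
def HasCyclicParameterColons (R : Type*) [CommRing R] [IsLocalRing R] : Prop :=
  ∀ a b : Ideal R, IsParameterIdeal R a → IsParameterIdeal R b → b ≤ a →
    ∃ c, (∀ r, r * c ∈ b ↔ r ∈ a) ∧ ∀ z, (∀ r ∈ a, r * z ∈ b) → ∃ α, z - α * c ∈ b

section

variable {R : Type*} [CommRing R] [IsLocalRing R]

theorem IsLocalRing.isUnit_add_of_mem_maximalIdeal {u y : R} (hu : IsUnit u)
    (hy : y ∈ maximalIdeal R) : IsUnit (u + y) := by
  by_contra h
  have := Ideal.sub_mem _ ((mem_maximalIdeal _).2 h) hy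
  rw [add_sub_cancel_right] at this
  exact (mem_maximalIdeal _).1 this hu

theorem HasCyclicParameterColons.quotient_span_singleton (h : HasCyclicParameterColons R) {x : R}
    (hx : x ∈ maximalIdeal R) [IsLocalRing (R ⧸ Ideal.span {x})]
    (hdim : ringKrullDim R = ringKrullDim (R ⧸ Ideal.span {x}) + 1) :
    HasCyclicParameterColons (R ⧸ Ideal.span {x}) := by
  intro a b ha hb hba
  obtain ⟨c, hc, hz⟩ := h _ _ (ha.comap_mk hx hdim) (hb.comap_mk hx hdim) (Ideal.comap_mono hba)
  refine ⟨Ideal.Quotient.mk _ c, fun r ↦ ?_, fun z hz' ↦ ?_⟩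
  · obtain ⟨r, rfl⟩ := Ideal.Quotient.mk_surjective r
    rw [← map_mul]
    exact hc r
  · obtain ⟨z, rfl⟩ := Ideal.Quotient.mk_surjective z
    obtain ⟨α, hα⟩ := hz z fun r hr ↦ by
      rw [Ideal.mem_comap, map_mul]
      exact hz' _ hr
    exact ⟨Ideal.Quotient.mk _ α, by rwa [← map_mul, ← map_sub]⟩

variable [IsNoetherianRing R]

theorem HasCyclicParameterColons.isSMulRegular_of_ringKrullDim_eq_one
    (h : HasCyclicParameterColons R) (hd : ringKrullDim R = 1) {x : R}
    (hrad : (Ideal.span {x}).radical = maximalIdeal R) : IsSMulRegular R x := by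
  have hxm : x ∈ maximalIdeal R := hrad ▸ Ideal.le_radical (Ideal.mem_span_singleton_self x)
  have hpar (n : ℕ) : IsParameterIdeal R (Ideal.span {x ^ (n + 1)}) := by
    refine ⟨1, fun _ ↦ x ^ (n + 1), hd, fun _ ↦ Ideal.pow_mem_of_mem _ hxm _ n.succ_pos,
      by rw [Set.range_const], ?_⟩
    rw [← Ideal.span_singleton_pow, Ideal.radical_pow _ n.succ_ne_zero, hrad]
  have hnil (n : ℕ) : x ^ n ≠ 0 := fun hn ↦ by
    have : ringKrullDim R ≤ (0 : ℕ) := by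
      refine ringKrullDim_le_of_radical_span (a := (Fin.elim0 : Fin 0 → R)) ?_
      rw [← hrad, Set.range_eq_empty, Ideal.span_empty]
      refine le_antisymm (Ideal.radical_mono bot_le) (Ideal.radical_le_radical_iff.2 ?_)
      rw [Ideal.span_singleton_le_iff_mem]
      exact ⟨n, hn⟩
    rw [hd] at this
    norm_cast at this
  obtain ⟨N, hN⟩ := monotone_stabilizes_iff_noetherian.2 (inferInstanceAs (IsNoetherian R R))
    ⟨fun n ↦ (LinearMap.toSpanSingleton R R (x ^ n)).ker, monotone_nat_of_le_succ fun n r hr ↦ by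
      have hr' : r * x ^ n = 0 := hr
      change r * x ^ (n + 1) = 0
      rw [pow_succ, ← mul_assoc, hr', zero_mul]⟩
  have hN' (r : R) (hr : r * x ^ (N + 1) = 0) : r * x ^ N = 0 :=
    (hN (N + 1) N.le_succ).ge (x := r) hr
  obtain ⟨c, hc, hz⟩ := h (Ideal.span {x}) (Ideal.span {x ^ (N + 1)}) (by simpa using hpar 0)
    (hpar N) (Ideal.span_singleton_le_span_singleton.2 (dvd_pow_self x N.succ_ne_zero))
  have hx_mul {z : R} (hxz : x * z ∈ Ideal.span {x ^ (N + 1)}) :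
      ∃ α s, z = α * c + s * x ^ (N + 1) := by
    obtain ⟨α, hα⟩ := hz z fun r hr ↦ by
      obtain ⟨t, rfl⟩ := Ideal.mem_span_singleton'.1 hr
      rw [mul_assoc]
      exact Ideal.mul_mem_left _ _ hxz
    obtain ⟨s, hs⟩ := Ideal.mem_span_singleton'.1 hα
    exact ⟨α, s, by rw [hs]; ring⟩
  obtain ⟨r, hr⟩ := Ideal.mem_span_singleton'.1 ((hc x).2 (Ideal.mem_span_singleton_self x))
  obtain ⟨w, hw⟩ : ∃ w, c = r * x ^ N + w := ⟨c - r * x ^ N, by ring⟩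
  have hxw : x * w = 0 := by
    rw [hw] at hr
    linear_combination -hr
  have hru : IsUnit r := by
    by_contra hru
    obtain ⟨α, s, hs⟩ := hx_mul (z := x ^ N)
      (by rw [← pow_succ']; exact Ideal.mem_span_singleton_self _)
    have hu : IsUnit (1 + -(α * r + s * x)) := isUnit_add_of_mem_maximalIdeal isUnit_one
      (neg_mem (add_mem (Ideal.mul_mem_left _ _ ((mem_maximalIdeal r).2 hru))
        (Ideal.mul_mem_left _ _ hxm)))
    refine hnil (N + 1) (hu.mul_right_eq_zero.1 ?_)
    rw [hw] at hs
    linear_combination x * hs + α * hxw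
  have key (z : R) (hxz : x * z = 0) : ∃ α ∈ maximalIdeal R, z = α * w := by
    obtain ⟨α, s, hs⟩ := hx_mul (z := z) (by rw [hxz]; exact zero_mem _)
    have h0 : (α * r + s * x) * x ^ N = 0 := hN' _ <| by
      rw [hw] at hs
      linear_combination hxz - x * hs - α * hxw
    refine ⟨α, fun hα ↦ ?_, by rw [hs, hw]; linear_combination h0⟩
    exact hnil N ((isUnit_add_of_mem_maximalIdeal (hα.mul hru)
      (Ideal.mul_mem_left _ s hxm)).mul_right_eq_zero.1 h0)
  have hw0 : w = 0 := by
    obtain ⟨α, hα, hαw⟩ := key w hxw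
    have hu : IsUnit (1 + -α) := isUnit_add_of_mem_maximalIdeal isUnit_one (neg_mem hα)
    refine hu.mul_right_eq_zero.1 ?_
    linear_combination hαw
  rw [isSMulRegular_iff_right_eq_zero_of_smul]
  intro z hz
  obtain ⟨α, -, rfl⟩ := key z hz
  rw [hw0, mul_zero]

theorem exists_parameters {d : ℕ} (hd : ringKrullDim R = d) :
    ∃ a : Fin d → R, (∀ i, a i ∈ maximalIdeal R) ∧
      (Ideal.span (Set.range a)).radical = maximalIdeal R := by
  obtain ⟨_, d', a, hd', ha, rfl, hrad⟩ := exists_isParameterIdeal R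
  obtain rfl : d' = d := by
    rw [hd] at hd'
    exact_mod_cast hd'.symm
  exact ⟨a, ha, hrad⟩

theorem HasCyclicParameterColons.eq_zero_of_maximalIdeal_mul_eq_zero {R : Type*} [CommRing R]
    [IsLocalRing R] [IsNoetherianRing R] (h : HasCyclicParameterColons R)
    {d : ℕ} (hd : ringKrullDim R = (d + 1 : ℕ)) {z : R}
    (hz : ∀ y ∈ maximalIdeal R, y * z = 0) : z = 0 := by
  induction d generalizing R with
  | zero =>
    obtain ⟨a, ha, hrad⟩ := exists_parameters hd
    have hrad' : (Ideal.span {a 0}).radical = maximalIdeal R := by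
      have : Set.range a = {a 0} := Set.range_unique (ι := Fin 1)
      rw [← hrad, this]
    have := h.isSMulRegular_of_ringKrullDim_eq_one (by simpa using hd) hrad'
    exact this.right_eq_zero_of_smul (hz _ (ha 0))
  | succ d ih =>
    obtain ⟨a, ha, hrad⟩ := exists_parameters hd
    have hbot := Ideal.iInf_pow_eq_bot_of_isLocalRing (Ideal.span {a 0})
      (span_singleton_ne_top_of_mem_maximalIdeal (ha 0))
    refine (Ideal.mem_bot (R := R)).1 (hbot.le ((Submodule.mem_iInf _).2 fun n ↦ ?_))
    refine Ideal.pow_le_pow_right n.le_succ ?_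
    rw [Ideal.span_singleton_pow]
    let a' : Fin (d + 1 + 1) → R := Fin.cons (a 0 ^ (n + 1)) fun i ↦ a i.succ
    have ha' : ∀ i, a' i ∈ maximalIdeal R :=
      Fin.cases (Ideal.pow_mem_of_mem _ (ha 0) _ n.succ_pos) fun i ↦ ha i.succ
    have hrad' : (Ideal.span (Set.range a')).radical = maximalIdeal R := by
      refine le_antisymm ?_ ?_
      · rw [(maximalIdeal.isMaximal R).isPrime.radical_le_iff, Ideal.span_le]
        rintro _ ⟨i, rfl⟩
        exact ha' i
      · rw [← hrad, Ideal.radical_le_radical_iff, Ideal.span_le]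
        rintro _ ⟨i, rfl⟩
        refine Fin.cases ⟨n + 1, Ideal.subset_span ⟨0, rfl⟩⟩ (fun i ↦ ?_) i
        exact Ideal.le_radical (Ideal.subset_span ⟨i.succ, rfl⟩)
    have := quotient_of_ne_top (span_singleton_ne_top_of_mem_maximalIdeal (ha' 0))
    change z ∈ Ideal.span {a' 0}
    have hdim := (ringKrullDim_quotient_parameter hd ha' hrad').1
    have h' := h.quotient_span_singleton (ha' 0) (by rw [hd, hdim]; rfl)
    refine Ideal.Quotient.eq_zero_iff_mem.1 (ih h' hdim fun y hy ↦ ?_)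
    obtain ⟨y, rfl⟩ := Ideal.Quotient.mk_surjective y
    rw [← map_mul, hz y (mk_mem_maximalIdeal_iff.1 hy), map_zero]

end

theorem exists_mem_maximalIdeal_mul_mem {R : Type*} [CommRing R] [IsLocalRing R]
    [IsNoetherianRing R] {b J : Ideal R} (hrad : b.radical = maximalIdeal R) (hJ : ¬ J ≤ b) :
    ∃ s ∈ J, s ∉ b ∧ ∀ y ∈ maximalIdeal R, y * s ∈ b := by
  classical
  have hex : ∃ n, maximalIdeal R ^ n * J ≤ b := by
    obtain ⟨n, hn⟩ := b.exists_radical_pow_le_of_fg (IsNoetherian.noetherian _)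
    rw [hrad] at hn
    exact ⟨n, Ideal.mul_le_left.trans hn⟩
  obtain ⟨k, hk⟩ : ∃ k, Nat.find hex = k + 1 := Nat.exists_eq_succ_of_ne_zero fun h0 ↦ hJ <| by
    simpa [h0] using Nat.find_spec hex
  have h1 := Nat.find_spec hex
  rw [hk] at h1
  have h2 : ¬ maximalIdeal R ^ k * J ≤ b := Nat.find_min hex (by lia)
  obtain ⟨s, hs, hsb⟩ := SetLike.not_le_iff_exists.1 h2
  refine ⟨s, Ideal.mul_le_right hs, hsb, fun y hy ↦ h1 ?_⟩
  rw [pow_succ', mul_assoc]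
  exact Ideal.mul_mem_mul hy hs

theorem HasCyclicParameterColons.isIrreducibleIdeal_of_le {R : Type*} [CommRing R] [IsLocalRing R]
    [IsNoetherianRing R] (h : HasCyclicParameterColons R) {a b : Ideal R}
    (ha : IsParameterIdeal R a) (hb : IsParameterIdeal R b) (hba : b ≤ a)
    (hirr : IsIrreducibleIdeal a) : IsIrreducibleIdeal b := by
  refine ⟨ne_top_of_le_ne_top hirr.1 hba, fun J K hJK ↦ ?_⟩
  by_contra! hcon
  obtain ⟨c, hc, hgen⟩ := h a b ha hb hba
  have hbJ : b ≤ J := hJK ▸ inf_le_left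
  have hbK : b ≤ K := hJK ▸ inf_le_right
  obtain ⟨s, hsJ, hsb, hms⟩ := exists_mem_maximalIdeal_mul_mem hb.radical
    fun h ↦ hcon.1 (le_antisymm hbJ h)
  obtain ⟨t, htK, htb, hmt⟩ := exists_mem_maximalIdeal_mul_mem hb.radical
    fun h ↦ hcon.2 (le_antisymm hbK h)
  obtain ⟨α, hα⟩ := hgen s fun r hr ↦ hms r (ha.le_maximalIdeal hr)
  obtain ⟨β, hβ⟩ := hgen t fun r hr ↦ hmt r (ha.le_maximalIdeal hr)
  have hαa : α ∉ a := fun hα' ↦ hsb <| by simpa using b.add_mem hα ((hc α).2 hα')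
  have hβa : β ∉ a := fun hβ' ↦ htb <| by simpa using b.add_mem hβ ((hc β).2 hβ')
  have hmα (y : R) (hy : y ∈ maximalIdeal R) : y * α ∈ a := by
    rw [← hc]
    convert b.sub_mem (hms y hy) (b.mul_mem_left y hα) using 1
    ring
  have hne : a ≠ (a ⊔ Ideal.span {α}) ⊓ (a ⊔ Ideal.span {β}) := fun heq ↦ by
    rcases hirr.2 _ _ heq with h | h
    · exact hαa (h ▸ Ideal.mem_sup_right (Ideal.mem_span_singleton_self α))
    · exact hβa (h ▸ Ideal.mem_sup_right (Ideal.mem_span_singleton_self β))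
  obtain ⟨v, ⟨hv1, hv2⟩, hva⟩ := SetLike.exists_of_lt
    (lt_of_le_of_ne (le_inf le_sup_left le_sup_left) hne)
  obtain ⟨i, hi, _, hu, rfl⟩ := Submodule.mem_sup.1 hv1
  obtain ⟨u, rfl⟩ := Ideal.mem_span_singleton'.1 hu
  obtain ⟨i', hi', _, hu', heq⟩ := Submodule.mem_sup.1 hv2
  obtain ⟨u', rfl⟩ := Ideal.mem_span_singleton'.1 hu'
  have huu : IsUnit u := by
    by_contra huu
    exact hva (add_mem hi (hmα u ((mem_maximalIdeal u).2 huu)))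
  have hust : u * s - u' * t ∈ b := by
    have := b.add_mem (b.sub_mem (b.mul_mem_left u hα) (b.mul_mem_left u' hβ))
      ((hc (i' - i)).2 (a.sub_mem hi' hi))
    convert this using 1
    linear_combination (-c) * heq
  have hus : u * s ∈ K := by simpa using K.add_mem (hbK hust) (K.mul_mem_left u' htK)
  exact hsb (hJK ▸ ⟨hsJ, (Ideal.unit_mul_mem_iff_mem _ huu).1 hus⟩)

theorem IsIrreducibleIdeal.of_comap_of_surjective {R S : Type*} [CommRing R] [CommRing S]
    {f : R →+* S} (hf : Function.Surjective f) {b : Ideal S}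
    (h : IsIrreducibleIdeal (b.comap f)) : IsIrreducibleIdeal b := by
  refine ⟨fun hb ↦ h.1 (by rw [hb, Ideal.comap_top]), fun J K hJK ↦ ?_⟩
  refine (h.2 (J.comap f) (K.comap f) (by rw [hJK, Ideal.comap_inf])).imp ?_ ?_ <;>
  exact fun h ↦ Ideal.comap_injective_of_surjective f hf h

theorem HasCyclicParameterColons.exists_isParameterIdeal_le {R : Type u} [CommRing R]
    [IsLocalRing R] [IsNoetherianRing R] (h : HasCyclicParameterColons R) {I : Ideal R}
    (hI : I.radical = maximalIdeal R) :
    ∃ b ≤ I, IsParameterIdeal R b ∧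
      (IsIrreducibleIdeal b → ∃ n, Module.InjDimLT R R (n + 1)) := by
  obtain ⟨d, hd⟩ := exists_ringKrullDim_eq_natCast R
  induction d generalizing R with
  | zero =>
    obtain ⟨a, ha, hrad⟩ := exists_parameters hd
    rw [Set.range_eq_empty, Ideal.span_empty] at hrad
    refine ⟨⊥, bot_le, ⟨0, a, hd, ha, by simp [Set.range_eq_empty], hrad⟩, fun hirr ↦ ⟨0, ?_⟩⟩
    exact Module.InjDimLT.one_iff.2
      (Module.injective_self_of_isIrreducibleIdeal_bot hrad hirr)
  | succ d ih =>
    obtain ⟨x, hxI, hx⟩ | ⟨z, hz, hIz⟩ := I.exists_isSMulRegular_or_exists_annihilated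
    swap
    · obtain ⟨w, hw, hmw⟩ := exists_ne_zero_maximalIdeal_mul_eq_zero hI hz hIz
      exact absurd (h.eq_zero_of_maximalIdeal_mul_eq_zero hd hmw) hw
    have hxm : x ∈ maximalIdeal R := hI ▸ Ideal.le_radical hxI
    have := quotient_of_ne_top (span_singleton_ne_top_of_mem_maximalIdeal hxm)
    have hdim := ringKrullDim_quotient_span_singleton_succ_eq_ringKrullDim hx hxm
    have hdS : ringKrullDim (R ⧸ Ideal.span {x}) = d := by
      obtain ⟨e, he⟩ := exists_ringKrullDim_eq_natCast (R ⧸ Ideal.span {x})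
      rw [he, hd] at hdim
      rw [he]
      norm_cast at hdim ⊢
      lia
    have hcomap : (I.map (Ideal.Quotient.mk (Ideal.span {x}))).comap (Ideal.Quotient.mk _) = I :=
      Ideal.comap_map_mk ((Ideal.span_singleton_le_iff_mem _).2 hxI)
    obtain ⟨b, hbI, hb, hirr⟩ := ih (h.quotient_span_singleton hxm hdim.symm)
      (I := I.map (Ideal.Quotient.mk (Ideal.span {x})))
      (by rw [← radical_comap_mk_eq_maximalIdeal_iff, hcomap, hI]) hdS
    refine ⟨b.comap (Ideal.Quotient.mk _), (Ideal.comap_mono hbI).trans hcomap.le,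
      hb.comap_mk hxm hdim.symm, fun hirr' ↦ ?_⟩
    obtain ⟨n, hn⟩ := hirr (hirr'.of_comap_of_surjective Ideal.Quotient.mk_surjective)
    exact ⟨n + 1, Module.InjDimLT.of_quotient_self hxm hx hn⟩

theorem gorenstein_iff_hom_quotient_iso_and_exists_irreducible_parameter (R : Type*) [CommRing R] [IsNoetherianRing R] [IsLocalRing R] :
    HasFiniteInjectiveDimension R ↔
      ((∀ a b : Ideal R, IsParameterIdeal R a → IsParameterIdeal R b → b ≤ a →
          Nonempty (((R ⧸ a) →ₗ[R] (R ⧸ b)) ≃ₗ[R] (R ⧸ a))) ∧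
        ∃ I : Ideal R, IsParameterIdeal R I ∧ IsIrreducibleIdeal I) := by
  rw [hasFiniteInjectiveDimension_iff]
  constructor
  · rintro ⟨n, hn⟩
    have h : Module.InjDimLT R R (n + 1) := Module.InjDimLT.mono hn n.le_succ
    refine ⟨fun a b ha hb hba ↦ nonempty_hom_quotient_equiv_of_injDimLT h ha hb hba, ?_⟩
    obtain ⟨b, hb⟩ := exists_isParameterIdeal R
    exact ⟨b, hb, isIrreducibleIdeal_of_injective_quotient hb.radical (hb.injective_quotient h)⟩
  · rintro ⟨h, I, hI, hirr⟩
    have h' : HasCyclicParameterColons R := fun a b ha hb hba ↦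
      nonempty_hom_quotient_equiv_iff.1 (h a b ha hb hba)
    obtain ⟨b, hbI, hb, hfin⟩ := h'.exists_isParameterIdeal_le hI.radical
    obtain ⟨n, hn⟩ := hfin (h'.isIrreducibleIdeal_of_le hI hb hbI hirr)
    exact ⟨n + 1, hn⟩
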